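/- arXiv:2312.06124 — 2 statements merged into one kernel-verified Lean document; each statement's English description precedes it below -/
import Mathlib

section
/- Let R be a Cohen-Macaulay local ring of dimension d and let M be a finitely generated R-module such that Hom_R(M,R) has finite Gorenstein dimension. If Hom_R(M,M) is a free R-module and Ext^j_R(M,M) = 0 for all 1 ≤ j ≤ d, then M is free. -/
open CategoryTheory Opposite

universe u

noncomputable section

/-- The Ext module `Ext^i_R(M,N)`. -/
def ExtMod (R : Type u) [CommRing R] (M N : ModuleCat.{u} R) (i : ℕ) : ModuleCat.{u} R :=
  ((Ext R (ModuleCat.{u} R) i).obj (op M)).obj N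

/-- The Tor module `Tor_i^R(M,N)`. -/
def TorMod (R : Type u) [CommRing R] (M N : ModuleCat.{u} R) (i : ℕ) : ModuleCat.{u} R :=
  ((Tor (ModuleCat.{u} R) i).obj M).obj N

/-- The depth of a module over a local ring, as the least `i` with
`Ext^i(k, M) ≠ 0`. -/
def moduleDepth (R : Type u) [CommRing R] [IsLocalRing R] (M : ModuleCat.{u} R) : ℕ∞ :=
  sInf {i : ℕ∞ | ∃ n : ℕ, i = n ∧
    Nontrivial (ExtMod R (ModuleCat.of R (IsLocalRing.ResidueField R)) M n)}

/-- A Cohen-Macaulay local ring of dimension `d`. -/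
def IsCMLocalOfDim (R : Type u) [CommRing R] [IsLocalRing R] [IsNoetherianRing R] (d : ℕ) : Prop :=
  ringKrullDim R = d ∧ moduleDepth R (ModuleCat.of R R) = d

/-- Totally reflexive modules. -/
def TotallyReflexive (R : Type u) [CommRing R] (M : Type u) [AddCommGroup M] [Module R M] : Prop :=
  Function.Bijective (Module.Dual.eval R M) ∧
  ∀ i : ℕ, 1 ≤ i →
    Subsingleton (ExtMod R (ModuleCat.of R M) (ModuleCat.of R R) i) ∧
    Subsingleton (ExtMod R (ModuleCat.of R (Module.Dual R M)) (ModuleCat.of R R) i)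

/-- `GdimLE R n M` : the Gorenstein dimension of `M` is at most `n`. -/
def GdimLE (R : Type u) [CommRing R] : ℕ → ModuleCat.{u} R → Prop
  | 0, M => TotallyReflexive R M
  | (n+1), M => ∃ (G : ModuleCat.{u} R) (g : G →ₗ[R] M), Module.Finite R G ∧
      TotallyReflexive R G ∧ Function.Surjective g ∧
      GdimLE R n (ModuleCat.of R (LinearMap.ker g))

/-- Finite Gorenstein dimension. -/
def FiniteGdim (R : Type u) [CommRing R] (M : Type u) [AddCommGroup M] [Module R M] : Prop :=
  ∃ n, GdimLE R n (ModuleCat.of R M)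

/-- `PdLE R n M` : the projective dimension of `M` is at most `n`. -/
def PdLE (R : Type u) [CommRing R] : ℕ → ModuleCat.{u} R → Prop
  | 0, M => Module.Projective R M
  | (n+1), M => ∃ (G : ModuleCat.{u} R) (g : G →ₗ[R] M), Module.Projective R G ∧
      Function.Surjective g ∧ PdLE R n (ModuleCat.of R (LinearMap.ker g))

/-- Finite projective dimension. -/
def FinitePd (R : Type u) [CommRing R] (M : Type u) [AddCommGroup M] [Module R M] : Prop :=
  ∃ n, PdLE R n (ModuleCat.of R M)

/-- A semidualizing module. -/
def Semidualizing (R : Type u) [CommRing R] (C : Type u) [AddCommGroup C] [Module R C] : Prop :=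
  Module.Finite R C ∧
  Function.Bijective (LinearMap.toSpanSingleton R (C →ₗ[R] C) LinearMap.id) ∧
  ∀ i : ℕ, 1 ≤ i → Subsingleton (ExtMod R (ModuleCat.of R C) (ModuleCat.of R C) i)

/-- Membership in the Auslander class with respect to `C`. -/
def InAuslanderClass (R : Type u) [CommRing R] (C : Type u) [AddCommGroup C] [Module R C]
    (X : Type u) [AddCommGroup X] [Module R X] : Prop :=
  Function.Bijective ((TensorProduct.mk R C X).flip) ∧
  (∀ i : ℕ, 1 ≤ i → Subsingleton (TorMod R (ModuleCat.of R C) (ModuleCat.of R X) i)) ∧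
  (∀ i : ℕ, 1 ≤ i →
    Subsingleton (ExtMod R (ModuleCat.of R C) (ModuleCat.of R (TensorProduct R C X)) i))

/-- Height of a prime ideal. -/
def primeHt (R : Type u) [CommRing R] (p : Ideal R) (hp : p.IsPrime) : ℕ∞ :=
  Order.height (⟨p, hp⟩ : PrimeSpectrum R)

/-- Finite injective dimension, via vanishing of `Ext` in high degrees. -/
def FiniteInjDim (R : Type u) [CommRing R] (M : Type u) [AddCommGroup M] [Module R M] : Prop :=
  ∃ n : ℕ, ∀ (N : ModuleCat.{u} R) (i : ℕ), n < i →
    Subsingleton (ExtMod R N (ModuleCat.of R M) i)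

/-- A canonical (dualizing) module over a Cohen-Macaulay local ring:
a semidualizing module of finite injective dimension. -/
def IsCanonicalModule (R : Type u) [CommRing R] (w : Type u) [AddCommGroup w] [Module R w] : Prop :=
  Semidualizing R w ∧ FiniteInjDim R w

end
noncomputable section

namespace Aux

variable {R : Type u} [CommRing R]

/-- Yoneda Ext of modules. -/
abbrev E (R : Type u) [CommRing R] (L Y : Type u) [AddCommGroup L] [Module R L]
    [AddCommGroup Y] [Module R Y] (i : ℕ) :=
  Abelian.Ext (ModuleCat.of R L) (ModuleCat.of R Y) i

section basic

variable {L L' L'' Y Y' Y'' : Type u} [AddCommGroup L] [Module R L] [AddCommGroup L'] [Module R L']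
  [AddCommGroup L''] [Module R L'']
  [AddCommGroup Y] [Module R Y] [AddCommGroup Y'] [Module R Y'] [AddCommGroup Y''] [Module R Y'']

/-- covariant functoriality -/
def post {i : ℕ} (f : Y →ₗ[R] Y') : E R L Y i →ₗ[R] E R L Y' i where
  toFun e := e.comp (Abelian.Ext.mk₀ (ModuleCat.ofHom f)) (add_zero i)
  map_add' a b := by simp
  map_smul' r a := by simp

/-- contravariant functoriality -/
def pre {i : ℕ} (f : L →ₗ[R] L') : E R L' Y i →ₗ[R] E R L Y i where
  toFun e := (Abelian.Ext.mk₀ (ModuleCat.ofHom f)).comp e (zero_add i)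
  map_add' a b := by simp
  map_smul' r a := by simp

lemma post_comp {i : ℕ} (f : Y →ₗ[R] Y') (g : Y' →ₗ[R] Y'') (e : E R L Y i) :
    post g (post f e) = post (g ∘ₗ f) e := by
  simp only [post, LinearMap.coe_mk, AddHom.coe_mk]
  rw [Abelian.Ext.comp_assoc_of_third_deg_zero, Abelian.Ext.mk₀_comp_mk₀]
  rfl

lemma pre_comp {i : ℕ} (f : L →ₗ[R] L') (g : L' →ₗ[R] L'') (e : E R L'' Y i) :
    pre f (pre g e) = pre (g ∘ₗ f) e := by
  simp only [pre, LinearMap.coe_mk, AddHom.coe_mk]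
  rw [Abelian.Ext.mk₀_comp_mk₀_assoc]
  rfl

@[simp] lemma post_id {i : ℕ} (e : E R L Y i) : post (LinearMap.id : Y →ₗ[R] Y) e = e := by
  simp [post]

@[simp] lemma pre_id {i : ℕ} (e : E R L Y i) : pre (LinearMap.id : L →ₗ[R] L) e = e := by
  simp [pre]

lemma post_add {i : ℕ} (f g : Y →ₗ[R] Y') (e : E R L Y i) :
    post (f + g) e = post f e + post g e := by
  simp [post, ModuleCat.ofHom_add, Abelian.Ext.mk₀_add]

lemma pre_add {i : ℕ} (f g : L →ₗ[R] L') (e : E R L' Y i) :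
    pre (f + g) e = pre f e + pre g e := by
  simp [pre, ModuleCat.ofHom_add, Abelian.Ext.mk₀_add]

lemma post_smul {i : ℕ} (r : R) (f : Y →ₗ[R] Y') (e : E R L Y i) :
    post (r • f) e = r • post f e := by
  have : ModuleCat.ofHom (r • f) = r • ModuleCat.ofHom f := rfl
  simp [post, this, Abelian.Ext.mk₀_smul]

lemma pre_smul {i : ℕ} (r : R) (f : L →ₗ[R] L') (e : E R L' Y i) :
    pre (r • f) e = r • pre f e := by
  have : ModuleCat.ofHom (r • f) = r • ModuleCat.ofHom f := rfl
  simp [pre, this, Abelian.Ext.mk₀_smul]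

@[simp] lemma post_zero {i : ℕ} (e : E R L Y i) : post (0 : Y →ₗ[R] Y') e = 0 := by
  have := post_smul (0 : R) (0 : Y →ₗ[R] Y') e
  simpa using this

@[simp] lemma pre_zero {i : ℕ} (e : E R L' Y i) : pre (0 : L →ₗ[R] L') e = 0 := by
  have := pre_smul (0 : R) (0 : L →ₗ[R] L') e
  simpa using this

lemma post_sum {i : ℕ} {ι : Type*} (s : Finset ι) (f : ι → (Y →ₗ[R] Y')) (e : E R L Y i) :
    post (∑ j ∈ s, f j) e = ∑ j ∈ s, post (f j) e := by
  classical
  induction s using Finset.induction_on with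
  | empty => simp
  | insert a s ha ih => rw [Finset.sum_insert ha, Finset.sum_insert ha, post_add, ih]

/-- homs are degree zero classes -/
def hom0 : (L →ₗ[R] Y) ≃ₗ[R] E R L Y 0 :=
  LinearEquiv.symm ((Abelian.Ext.linearEquiv₀ (R := R)).trans ModuleCat.homLinearEquiv)

lemma post_hom0 (f : Y →ₗ[R] Y') (g : L →ₗ[R] Y) : post f (hom0 g) = hom0 (f ∘ₗ g) := by
  change (Abelian.Ext.mk₀ (ModuleCat.ofHom g)).comp (Abelian.Ext.mk₀ (ModuleCat.ofHom f)) (add_zero 0) =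
    Abelian.Ext.mk₀ (ModuleCat.ofHom (f ∘ₗ g))
  rw [Abelian.Ext.mk₀_comp_mk₀]
  rfl

lemma pre_hom0 (f : L →ₗ[R] L') (g : L' →ₗ[R] Y) : pre f (hom0 g) = hom0 (g ∘ₗ f) := by
  change (Abelian.Ext.mk₀ (ModuleCat.ofHom f)).comp (Abelian.Ext.mk₀ (ModuleCat.ofHom g)) (zero_add 0) =
    Abelian.Ext.mk₀ (ModuleCat.ofHom (g ∘ₗ f))
  rw [Abelian.Ext.mk₀_comp_mk₀]
  rfl

end basic

section les

variable {A B C X : Type u} [AddCommGroup A] [Module R A] [AddCommGroup B] [Module R B]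
  [AddCommGroup C] [Module R C] [AddCommGroup X] [Module R X]

lemma shortExact_mk (f : A →ₗ[R] B) (g : B →ₗ[R] C) (hf : Function.Injective f)
    (hfg : Function.Exact f g) (hg : Function.Surjective g) :
    (ShortComplex.mk (ModuleCat.ofHom f) (ModuleCat.ofHom g)
      (by ext x; exact (hfg (f x)).2 ⟨x, rfl⟩)).ShortExact := by
  refine @ShortComplex.ShortExact.mk _ _ _ _ ?_ ?_ ?_
  · rw [ShortComplex.moduleCat_exact_iff]
    intro x hx
    exact (hfg x).1 hx
  · exact (ModuleCat.mono_iff_injective _).2 hf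
  · exact (ModuleCat.epi_iff_surjective _).2 hg

lemma les_cov (f : A →ₗ[R] B) (g : B →ₗ[R] C) (hf : Function.Injective f)
    (hfg : Function.Exact f g) (hg : Function.Surjective g) (n : ℕ) :
    ∃ δ : E R X C n →ₗ[R] E R X A (n+1),
      (∀ e, δ e = 0 ↔ ∃ e', post g e' = e) ∧ (∀ e, post f e = 0 ↔ ∃ e', δ e' = e) := by
  have hS := shortExact_mk f g hf hfg hg
  refine ⟨{ toFun := fun e => e.comp hS.extClass rfl
            map_add' := by intros; simp
            map_smul' := by intros; simp }, fun e => ⟨fun h => ?_, ?_⟩, fun e => ⟨fun h => ?_, ?_⟩⟩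
  · exact Abelian.Ext.covariant_sequence_exact₃ _ hS e rfl h
  · rintro ⟨e', rfl⟩
    change (e'.comp (Abelian.Ext.mk₀ (ModuleCat.ofHom g)) (add_zero n)).comp hS.extClass rfl = 0
    rw [Abelian.Ext.comp_assoc_of_second_deg_zero]
    have := hS.comp_extClass
    dsimp at this
    rw [this]; simp
  · exact Abelian.Ext.covariant_sequence_exact₁ _ hS e h rfl
  · rintro ⟨e', rfl⟩
    change (e'.comp hS.extClass rfl).comp (Abelian.Ext.mk₀ (ModuleCat.ofHom f)) (add_zero _) = 0
    rw [Abelian.Ext.comp_assoc_of_third_deg_zero]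
    have := hS.extClass_comp
    dsimp at this
    rw [this]; simp

lemma cov_mid (f : A →ₗ[R] B) (g : B →ₗ[R] C) (hf : Function.Injective f)
    (hfg : Function.Exact f g) (hg : Function.Surjective g) {n : ℕ} (e : E R X B n)
    (h : post g e = 0) : ∃ e', post f e' = e :=
  Abelian.Ext.covariant_sequence_exact₂ _ (shortExact_mk f g hf hfg hg) e h

lemma les_contra (f : A →ₗ[R] B) (g : B →ₗ[R] C) (hf : Function.Injective f)
    (hfg : Function.Exact f g) (hg : Function.Surjective g) (n : ℕ) :
    ∃ δ : E R A X n →ₗ[R] E R C X (n+1),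
      (∀ e, δ e = 0 ↔ ∃ e', pre f e' = e) ∧ (∀ e, pre g e = 0 ↔ ∃ e', δ e' = e) := by
  have hS := shortExact_mk f g hf hfg hg
  refine ⟨{ toFun := fun e => hS.extClass.comp e (add_comm 1 n)
            map_add' := by intros; simp
            map_smul' := by intros; simp }, fun e => ⟨fun h => ?_, ?_⟩, fun e => ⟨fun h => ?_, ?_⟩⟩
  · exact Abelian.Ext.contravariant_sequence_exact₁ hS _ e (add_comm 1 n) h
  · rintro ⟨e', rfl⟩
    exact hS.extClass_comp_assoc e' (h := add_comm 1 n)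
  · exact Abelian.Ext.contravariant_sequence_exact₃ hS _ e h (add_comm 1 n)
  · rintro ⟨e', rfl⟩
    exact hS.comp_extClass_assoc e' (add_comm 1 n)

lemma contra_mid (f : A →ₗ[R] B) (g : B →ₗ[R] C) (hf : Function.Injective f)
    (hfg : Function.Exact f g) (hg : Function.Surjective g) {n : ℕ} (e : E R B X n)
    (h : pre f e = 0) : ∃ e', pre g e' = e :=
  Abelian.Ext.contravariant_sequence_exact₂ (shortExact_mk f g hf hfg hg) _ e h

end les

section TE

variable (S : Submonoid R)

/-- Ext is S-torsion -/
def TE (L Y : Type u) [AddCommGroup L] [Module R L] [AddCommGroup Y] [Module R Y] (i : ℕ) : Prop :=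
  ∀ e : E R L Y i, ∃ s ∈ S, s • e = 0

/-- S-torsion module -/
def ModT (H : Type u) [AddCommGroup H] [Module R H] : Prop := ∀ h : H, ∃ s ∈ S, s • h = 0

variable {S}
variable {A B C X : Type u} [AddCommGroup A] [Module R A] [AddCommGroup B] [Module R B]
  [AddCommGroup C] [Module R C] [AddCommGroup X] [Module R X]

lemma tors_mid {M₁ M₂ M₃ : Type*} [AddCommGroup M₁] [Module R M₁] [AddCommGroup M₂] [Module R M₂]
    [AddCommGroup M₃] [Module R M₃] (f : M₁ →ₗ[R] M₂) (g : M₂ →ₗ[R] M₃)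
    (hex : ∀ x, g x = 0 → ∃ y, f y = x) (h1 : ∀ x : M₁, ∃ s ∈ S, s • x = 0)
    (h3 : ∀ x : M₃, ∃ s ∈ S, s • x = 0) (x : M₂) : ∃ s ∈ S, s • x = 0 := by
  obtain ⟨s, hs, h⟩ := h3 (g x)
  obtain ⟨y, hy⟩ := hex (s • x) (by rw [map_smul, h])
  obtain ⟨t, ht, h'⟩ := h1 y
  exact ⟨t * s, S.mul_mem ht hs, by rw [mul_smul, ← hy, ← map_smul, h', map_zero]⟩

section
variable (f : A →ₗ[R] B) (g : B →ₗ[R] C) (hf : Function.Injective f)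
    (hfg : Function.Exact f g) (hg : Function.Surjective g) {n : ℕ}

lemma TE.cov_mid (hf : Function.Injective f)
    (hfg : Function.Exact f g) (hg : Function.Surjective g)
    (h1 : TE S X A n) (h3 : TE S X C n) : TE S X B n :=
  tors_mid (post f) (post g) (fun e h => Aux.cov_mid f g hf hfg hg e h) h1 h3

lemma TE.cov_left (hf : Function.Injective f)
    (hfg : Function.Exact f g) (hg : Function.Surjective g)
    (h1 : TE S X C n) (h3 : TE S X B (n+1)) : TE S X A (n+1) := by
  obtain ⟨δ, h, h'⟩ := les_cov (X := X) f g hf hfg hg n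
  exact tors_mid δ (post f) (fun e he => (h' e).1 he) h1 h3

lemma TE.cov_right (hf : Function.Injective f)
    (hfg : Function.Exact f g) (hg : Function.Surjective g)
    (h1 : TE S X B n) (h3 : TE S X A (n+1)) : TE S X C n := by
  obtain ⟨δ, h, h'⟩ := les_cov (X := X) f g hf hfg hg n
  exact tors_mid (post g) δ (fun e he => (h e).1 he) h1 h3

lemma TE.contra_mid (hf : Function.Injective f)
    (hfg : Function.Exact f g) (hg : Function.Surjective g)
    (h1 : TE S A X n) (h3 : TE S C X n) : TE S B X n :=
  tors_mid (pre g) (pre f) (fun e h => Aux.contra_mid f g hf hfg hg e h) h3 h1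

lemma TE.contra_right (hf : Function.Injective f)
    (hfg : Function.Exact f g) (hg : Function.Surjective g)
    (h1 : TE S A X n) (h3 : TE S B X (n+1)) : TE S C X (n+1) := by
  obtain ⟨δ, h, h'⟩ := les_contra (X := X) f g hf hfg hg n
  exact tors_mid δ (pre g) (fun e he => (h' e).1 he) h1 h3

lemma TE.contra_left (hf : Function.Injective f)
    (hfg : Function.Exact f g) (hg : Function.Surjective g)
    (h1 : TE S B X n) (h3 : TE S C X (n+1)) : TE S A X n := by
  obtain ⟨δ, h, h'⟩ := les_contra (X := X) f g hf hfg hg n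
  exact tors_mid (pre f) δ (fun e he => (h e).1 he) h1 h3
end

lemma TE_zero_iff : TE S A B 0 ↔ ∀ f : A →ₗ[R] B, ∃ s ∈ S, s • f = 0 := by
  constructor
  · intro h f
    obtain ⟨s, hs, hh⟩ := h (hom0 f)
    refine ⟨s, hs, ?_⟩
    rw [← map_smul] at hh
    exact (LinearEquiv.map_eq_zero_iff hom0).1 hh
  · intro h e
    obtain ⟨f, rfl⟩ := hom0.surjective e
    obtain ⟨s, hs, hh⟩ := h f
    exact ⟨s, hs, by rw [← map_smul, hh, map_zero]⟩

lemma TE.cov_left0 (f : A →ₗ[R] B) (hf : Function.Injective f) (h : TE S X B 0) : TE S X A 0 := by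
  rw [TE_zero_iff] at h ⊢
  intro g
  obtain ⟨s, hs, hh⟩ := h (f ∘ₗ g)
  refine ⟨s, hs, ?_⟩
  ext x
  apply hf
  simpa using LinearMap.congr_fun hh x

lemma TE.contra_right0 (g : A →ₗ[R] B) (hg : Function.Surjective g) (h : TE S A X 0) :
    TE S B X 0 := by
  rw [TE_zero_iff] at h ⊢
  intro f
  obtain ⟨s, hs, hh⟩ := h (f ∘ₗ g)
  refine ⟨s, hs, ?_⟩
  ext x
  obtain ⟨y, rfl⟩ := hg x
  simpa using LinearMap.congr_fun hh y

lemma TE.congr_left {i : ℕ} (f : A ≃ₗ[R] B) (h : TE S A X i) : TE S B X i := by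
  intro e
  obtain ⟨s, hs, hh⟩ := h (pre f.toLinearMap e)
  refine ⟨s, hs, ?_⟩
  have := congrArg (pre f.symm.toLinearMap) hh
  rw [map_smul, pre_comp] at this
  simpa using this

lemma TE.congr_right {i : ℕ} (f : A ≃ₗ[R] B) (h : TE S X A i) : TE S X B i := by
  intro e
  obtain ⟨s, hs, hh⟩ := h (post f.symm.toLinearMap e)
  refine ⟨s, hs, ?_⟩
  have := congrArg (post f.toLinearMap) hh
  rw [map_smul, post_comp] at this
  simpa using this

lemma TE_of_subsingleton {i : ℕ} (h : Subsingleton (E R A B i)) : TE S A B i :=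
  fun _ => ⟨1, S.one_mem, Subsingleton.elim _ _⟩

lemma subsingleton_of_TE_bot {i : ℕ} (h : TE (⊥ : Submonoid R) A B i) :
    Subsingleton (E R A B i) := by
  refine ⟨fun a b => ?_⟩
  have key : ∀ a : E R A B i, a = 0 := by
    intro a
    obtain ⟨s, hs, hh⟩ := h a
    rw [Submonoid.mem_bot.1 hs] at hh
    simpa using hh
  rw [key a, key b]

lemma TE_of_projective [Module.Projective R A] {i : ℕ} : TE S A B (i+1) := by
  intro e
  have : Projective (ModuleCat.of R A) := inferInstance
  exact ⟨1, S.one_mem, by simpa using Abelian.Ext.eq_zero_of_projective e⟩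

lemma ModT.exists_smul [Module.Finite R A] (h : ModT S A) : ∃ s ∈ S, ∀ a : A, s • a = 0 := by
  classical
  obtain ⟨T, hT⟩ := Module.Finite.fg_top (R := R) (M := A)
  choose σ hσ hσ' using h
  refine ⟨∏ a ∈ T, σ a, S.prod_mem fun a _ => hσ a, fun a => ?_⟩
  have : a ∈ Submodule.span R (T : Set A) := by rw [hT]; trivial
  induction this using Submodule.span_induction with
  | mem x hx =>
    rw [← Finset.prod_erase_mul _ _ hx, mul_smul, hσ', smul_zero]
  | zero => simp
  | add x y _ _ hx hy => rw [smul_add, hx, hy, add_zero]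
  | smul r x _ hx => rw [smul_comm, hx, smul_zero]

lemma ModT.TE_left [Module.Finite R A] (h : ModT S A) {i : ℕ} : TE S A B i := by
  obtain ⟨s, hs, hh⟩ := h.exists_smul
  intro e
  refine ⟨s, hs, ?_⟩
  have : s • (LinearMap.id : A →ₗ[R] A) = 0 := by ext x; simp [hh]
  have h2 := pre_smul s (LinearMap.id : A →ₗ[R] A) e
  rw [this] at h2
  simpa using h2.symm

lemma ModT.TE_right [Module.Finite R B] (h : ModT S B) {i : ℕ} : TE S A B i := by
  obtain ⟨s, hs, hh⟩ := h.exists_smul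
  intro e
  refine ⟨s, hs, ?_⟩
  have : s • (LinearMap.id : B →ₗ[R] B) = 0 := by ext x; simp [hh]
  have h2 := post_smul s (LinearMap.id : B →ₗ[R] B) e
  rw [this] at h2
  simpa using h2.symm

lemma ModT.mid (f : A →ₗ[R] B) (g : B →ₗ[R] C) (hex : ∀ x, g x = 0 → ∃ y, f y = x)
    (h1 : ModT S A) (h3 : ModT S C) : ModT S B := tors_mid f g hex h1 h3

lemma ModT.of_injective (f : A →ₗ[R] B) (hf : Function.Injective f) (h : ModT S B) :
    ModT S A := by
  intro a
  obtain ⟨s, hs, hh⟩ := h (f a)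
  exact ⟨s, hs, hf (by simpa using hh)⟩

lemma ModT.of_surjective (f : A →ₗ[R] B) (hf : Function.Surjective f) (h : ModT S A) :
    ModT S B := by
  intro b
  obtain ⟨a, rfl⟩ := hf b
  obtain ⟨s, hs, hh⟩ := h a
  exact ⟨s, hs, by rw [← map_smul, hh, map_zero]⟩

end TE

end Aux

end

noncomputable section

namespace Aux

variable {R : Type u} [CommRing R]

lemma subsingleton_extMod_iff_homology (M N : ModuleCat.{u} R) (P : ProjectiveResolution M) (n : ℕ) :
    Subsingleton (ExtMod R M N n) ↔ (P.complex.linearYonedaObj R N).ExactAt n := by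
  rw [HomologicalComplex.exactAt_iff_isZero_homology, ← (P.isoExt (R := R) n N).isZero_iff,
    ModuleCat.isZero_iff_subsingleton]
  rfl

lemma bridge (M N : ModuleCat.{u} R) (n : ℕ) :
    Subsingleton (ExtMod R M N n) ↔ Subsingleton (Abelian.Ext M N n) := by
  obtain ⟨P⟩ := (inferInstance : HasProjectiveResolution M).out
  rw [subsingleton_extMod_iff_homology M N P]
  cases n with
  | zero =>
    rw [HomologicalComplex.exactAt_iff' _ 0 0 1 (by simp) (by simp),
      ShortComplex.moduleCat_exact_iff]
    constructor
    · intro h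
      refine ⟨fun a b => ?_⟩
      have key : ∀ a : Abelian.Ext M N 0, a = 0 := by
        intro a
        obtain ⟨f, hf, rfl⟩ := P.extMk_surjective a 1 rfl
        obtain ⟨g, hg⟩ := h f hf
        have h0 : f = 0 := by
          rw [← hg]
          have : ((P.complex.linearYonedaObj R N).sc' 0 0 1).f = 0 := by
            exact (P.complex.linearYonedaObj R N).shape 0 0 (by simp)
          rw [this]; rfl
        subst h0
        simp
      rw [key a, key b]
    · intro h f hf
      refine ⟨0, ?_⟩
      rw [map_zero]
      have hf' : P.complex.d 1 0 ≫ f = 0 := hf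
      have hepi : Epi (ShortComplex.mk _ _ P.complex_d_comp_π_f_zero).g := by
        exact (inferInstance : Epi (P.π.f 0))
      let φ := P.exact₀.desc f hf'
      have hφ : P.π.f 0 ≫ φ = f := P.exact₀.g_desc f hf'
      have : φ = 0 := by
        have h' : Subsingleton (Abelian.Ext (((ChainComplex.single₀ (ModuleCat R)).obj M).X 0) N 0) := h
        have := h'.elim (Abelian.Ext.mk₀ φ) 0
        exact (Abelian.Ext.mk₀_eq_zero_iff _).1 this
      change 0 = f
      rw [← hφ, this, Limits.comp_zero]
      rfl
  | succ n =>
    rw [HomologicalComplex.exactAt_iff' _ n (n+1) (n+2) (by simp) (by simp),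
      ShortComplex.moduleCat_exact_iff]
    constructor
    · intro h
      refine ⟨fun a b => ?_⟩
      have key : ∀ a : Abelian.Ext M N (n+1), a = 0 := by
        intro a
        obtain ⟨f, hf, rfl⟩ := P.extMk_surjective a (n+2) rfl
        obtain ⟨g, hg⟩ := h f hf
        exact (P.extMk_eq_zero_iff f (n+2) rfl hf n rfl).2 ⟨g, hg⟩
      rw [key a, key b]
    · intro h f hf
      exact (P.extMk_eq_zero_iff f (n+2) rfl hf n rfl).1 (Subsingleton.elim _ _)

lemma depth_lt [IsLocalRing R] {d : ℕ} {M : ModuleCat.{u} R} (h : moduleDepth R M = d) (i : ℕ)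
    (hi : i < d) : Subsingleton (E R (IsLocalRing.ResidueField R) M i) := by
  rw [E, ← bridge]
  by_contra hc
  rw [not_subsingleton_iff_nontrivial] at hc
  have : moduleDepth R M ≤ i := sInf_le ⟨i, rfl, hc⟩
  rw [h] at this
  exact absurd (by exact_mod_cast this) (not_le.2 hi)

lemma depth_eq [IsLocalRing R] {d : ℕ} {M : ModuleCat.{u} R} (h : moduleDepth R M = d) :
    Nontrivial (E R (IsLocalRing.ResidueField R) M d) := by
  rw [← not_subsingleton_iff_nontrivial, E, ← bridge, not_subsingleton_iff_nontrivial]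
  have hne : {i : ℕ∞ | ∃ n : ℕ, i = n ∧
    Nontrivial (ExtMod R (ModuleCat.of R (IsLocalRing.ResidueField R)) M n)}.Nonempty := by
    by_contra hc
    rw [Set.not_nonempty_iff_eq_empty] at hc
    rw [moduleDepth, hc, sInf_empty] at h
    exact absurd h (by simp)
  have := csInf_mem hne
  obtain ⟨n, hn, hnn⟩ := this
  rw [moduleDepth] at h
  rw [h] at hn
  have : d = n := by exact_mod_cast hn
  rw [this]; exact hnn

end Aux

end

noncomputable section

namespace Aux

variable {R : Type u} [CommRing R]

section general

variable {A B C X Y Z L : Type u} [AddCommGroup A] [Module R A] [AddCommGroup B] [Module R B]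
  [AddCommGroup C] [Module R C] [AddCommGroup X] [Module R X] [AddCommGroup Y] [Module R Y]
  [AddCommGroup Z] [Module R Z] [AddCommGroup L] [Module R L]

lemma extend_of_TE {S : Submonoid R} (f : A →ₗ[R] B) (g : B →ₗ[R] C) (hf : Function.Injective f)
    (hfg : Function.Exact f g) (hg : Function.Surjective g) (h : TE S C X 1) (φ : A →ₗ[R] X) :
    ∃ s ∈ S, ∃ ψ : B →ₗ[R] X, ψ ∘ₗ f = s • φ := by
  obtain ⟨δ, h1, h2⟩ := les_contra (X := X) f g hf hfg hg 0
  obtain ⟨s, hs, hh⟩ := h (δ (hom0 φ))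
  rw [← map_smul, h1] at hh
  obtain ⟨e, he⟩ := hh
  obtain ⟨ψ, rfl⟩ := hom0.surjective e
  rw [pre_hom0, ← map_smul] at he
  exact ⟨s, hs, ψ, hom0.injective he⟩

/-- decomposition of a class with coefficients in a Hom out of a finite free module -/
lemma post_eval_sum {n i : ℕ} (e : E R X ((Fin n → R) →ₗ[R] Y) i) :
    e = ∑ j, post ((LinearMap.lcomp R Y (LinearMap.proj j)) ∘ₗ
        (LinearMap.ringLmapEquivSelf R R Y).symm.toLinearMap)
      (post (LinearMap.applyₗ (Pi.single j (1:R) : Fin n → R)) e) := by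
  have key : (LinearMap.id : ((Fin n → R) →ₗ[R] Y) →ₗ[R] _) =
      ∑ j, ((LinearMap.lcomp R Y (LinearMap.proj j)) ∘ₗ
        (LinearMap.ringLmapEquivSelf R R Y).symm.toLinearMap) ∘ₗ
          (LinearMap.applyₗ (Pi.single j (1:R) : Fin n → R)) := by
    ext φ j
    simp [LinearMap.sum_apply, Pi.single_apply]
  conv_lhs => rw [← post_id e, key, post_sum]
  simp only [post_comp]

lemma TE_free_right {S : Submonoid R} {n i : ℕ} (h : TE S X Y i) :
    TE S X ((Fin n → R) →ₗ[R] Y) i := by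
  intro e
  choose s hs hs' using fun j : Fin n =>
    h (post (LinearMap.applyₗ (Pi.single j (1:R) : Fin n → R)) e)
  refine ⟨∏ j, s j, S.prod_mem fun j _ => hs j, ?_⟩
  rw [post_eval_sum e, Finset.smul_sum]
  refine Finset.sum_eq_zero fun j _ => ?_
  rw [← map_smul, ← Finset.prod_erase_mul _ _ (Finset.mem_univ j), mul_smul, hs', smul_zero,
    map_zero]

lemma surj_free_right {n i : ℕ} (f : Y →ₗ[R] Z) (h : ∀ e : E R X Z i, ∃ e', post f e' = e)
    (e : E R X ((Fin n → R) →ₗ[R] Z) i) : ∃ e', post (LinearMap.compRight R (M := Fin n → R) f) e' = e := by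
  choose g hg using fun j : Fin n =>
    h (post (LinearMap.applyₗ (Pi.single j (1:R) : Fin n → R)) e)
  refine ⟨∑ j, post ((LinearMap.lcomp R Y (LinearMap.proj j)) ∘ₗ
        (LinearMap.ringLmapEquivSelf R R Y).symm.toLinearMap) (g j), ?_⟩
  conv_rhs => rw [post_eval_sum e]
  rw [map_sum]
  refine Finset.sum_congr rfl fun j _ => ?_
  rw [← hg, post_comp, post_comp]
  refine congrArg (fun ψ => post ψ (g j)) ?_
  ext y v
  simp

/-- restriction of homs to the kernel -/
abbrev resKer {F : Type u} [AddCommGroup F] [Module R F] (π : F →ₗ[R] L) (Y : Type u)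
    [AddCommGroup Y] [Module R Y] :
    (F →ₗ[R] Y) →ₗ[R] (LinearMap.ker π →ₗ[R] Y) := LinearMap.lcomp R Y (LinearMap.ker π).subtype

lemma lcomp_inj {F : Type u} [AddCommGroup F] [Module R F] (π : F →ₗ[R] L)
    (hπ : Function.Surjective π) :
    Function.Injective (LinearMap.lcomp R Y π) := by
  intro f g h
  ext x
  obtain ⟨y, rfl⟩ := hπ x
  exact LinearMap.congr_fun h y

lemma lcomp_resKer_exact {F : Type u} [AddCommGroup F] [Module R F] (π : F →ₗ[R] L)
    (hπ : Function.Surjective π) :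
    Function.Exact (LinearMap.lcomp R Y π) (resKer π Y) := by
  intro f
  constructor
  · intro h
    have h' : LinearMap.ker π ≤ LinearMap.ker f := fun x hx => LinearMap.congr_fun h ⟨x, hx⟩
    refine ⟨(LinearMap.ker π).liftQ f h' ∘ₗ (π.quotKerEquivOfSurjective hπ).symm.toLinearMap, ?_⟩
    ext x
    have : (π.quotKerEquivOfSurjective hπ).symm (π x) = (LinearMap.ker π).mkQ x := by
      rw [LinearEquiv.symm_apply_eq]; rfl
    simp [this]
  · rintro ⟨g, rfl⟩
    ext x
    simp

lemma exact_ker {F : Type u} [AddCommGroup F] [Module R F] (π : F →ₗ[R] L) :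
    Function.Exact (LinearMap.ker π).subtype π := by
  intro x
  simp

lemma exact_rangeRestrict {f : A →ₗ[R] B} {g : B →ₗ[R] C} (h : Function.Exact f g) :
    Function.Exact f g.rangeRestrict := by
  intro x
  rw [← h x, ← LinearMap.mem_ker, LinearMap.ker_rangeRestrict, LinearMap.mem_ker]

lemma resKer_range_top {F : Type u} [AddCommGroup F] [Module R F] (π : F →ₗ[R] L)
    (hπ : Function.Surjective π) (h : TE (⊥ : Submonoid R) L Y 1) :
    LinearMap.range (resKer π Y) = ⊤ := by
  rw [LinearMap.range_eq_top]
  intro φ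
  obtain ⟨s, hs, ψ, hψ⟩ := extend_of_TE _ π (Submodule.subtype_injective _) (exact_ker π) hπ h φ
  rw [Submonoid.mem_bot.1 hs, one_smul] at hψ
  exact ⟨ψ, hψ⟩

lemma exists_cover (L : Type u) [AddCommGroup L] [Module R L] [Module.Finite R L] :
    ∃ (n : ℕ) (π : (Fin n → R) →ₗ[R] L), Function.Surjective π :=
  Module.Finite.exists_fin' R L

lemma lemC [IsNoetherianRing R] (s : ℕ) : ∀ (L : Type u) [AddCommGroup L] [Module R L] (n : ℕ)
    (π : (Fin n → R) →ₗ[R] L) (_ : Function.Surjective π)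
    (_ : ∀ i < s, TE (⊥ : Submonoid R) X Y i)
    (_ : ∀ j, 1 ≤ j → j + 1 ≤ s → TE (⊥ : Submonoid R) L Y j),
    ∀ i < s, TE (⊥ : Submonoid R) X (LinearMap.range (resKer π Y)) i := by
  induction s with
  | zero => intros; omega
  | succ s ih =>
    intro L _ _ n π hπ hY hL i hi
    obtain ⟨m, π1, hπ1⟩ := exists_cover (R := R) (LinearMap.ker π)
    cases i with
    | zero =>
      exact TE.cov_left0 (LinearMap.lcomp R Y π1 ∘ₗ (LinearMap.range (resKer π Y)).subtype)
        ((lcomp_inj π1 hπ1).comp (Submodule.subtype_injective _)) (TE_free_right (hY 0 (by omega)))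
    | succ i =>
      have htop := resKer_range_top π hπ (hL 1 le_rfl (by omega))
      refine TE.congr_right (A := (LinearMap.ker π →ₗ[R] Y))
        ((LinearEquiv.ofTop _ htop).symm) ?_
      refine TE.cov_left (LinearMap.lcomp R Y π1) (resKer π1 Y).rangeRestrict (lcomp_inj π1 hπ1)
        (exact_rangeRestrict (lcomp_resKer_exact π1 hπ1)) (LinearMap.surjective_rangeRestrict _)
        (ih _ m π1 hπ1 (fun i hi => hY i (by omega)) ?_ i (by omega))
        (TE_free_right (hY _ hi))
      intro j hj hj'
      exact TE.contra_left _ π (Submodule.subtype_injective _) (exact_ker π) hπ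
        (by obtain ⟨j, rfl⟩ := Nat.exists_eq_succ_of_ne_zero (by omega : j ≠ 0)
            exact TE_of_projective) (hL (j+1) (by omega) (by omega))

end general

section loc

variable [IsLocalRing R]
variable {A B C X Y Z L : Type u} [AddCommGroup A] [Module R A] [AddCommGroup B] [Module R B]
  [AddCommGroup C] [Module R C] [AddCommGroup X] [Module R X] [AddCommGroup Y] [Module R Y]
  [AddCommGroup Z] [Module R Z] [AddCommGroup L] [Module R L]

open IsLocalRing

lemma smul_E_k {r : R} (hr : r ∈ maximalIdeal R) {i : ℕ} (e : E R (ResidueField R) Y i) :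
    r • e = 0 := by
  have : r • (LinearMap.id : ResidueField R →ₗ[R] ResidueField R) = 0 := by
    ext
    simp [Algebra.smul_def, (residue_eq_zero_iff r).2 hr]
  have h2 := pre_smul r (LinearMap.id : ResidueField R →ₗ[R] ResidueField R) e
  rw [this] at h2
  simpa using h2.symm

lemma post_eq_zero_of_mem {i : ℕ} (f : Y →ₗ[R] Z)
    (hf : f ∈ (maximalIdeal R • ⊤ : Submodule R (Y →ₗ[R] Z))) (e : E R (ResidueField R) Y i) :
    post f e = 0 := by
  induction hf using Submodule.smul_induction_on' with
  | smul r hr g _ => rw [post_smul, smul_E_k hr]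
  | add g _ h _ hg hh => rw [post_add, hg, hh, add_zero]

lemma hom_mem_smul [Module.Free R A] [Module.Finite R A] (I : Ideal R) (f : A →ₗ[R] B)
    (hf : ∀ a, f a ∈ (I • ⊤ : Submodule R B)) :
    f ∈ (I • ⊤ : Submodule R (A →ₗ[R] B)) := by
  let b := Module.Free.chooseBasis R A
  have : f = ∑ l, LinearMap.smulRightₗ (b.coord l) (f (b l)) := by
    apply b.ext
    intro j
    simp [LinearMap.sum_apply, Finsupp.single_apply]
  rw [this]
  refine Submodule.sum_mem _ fun l _ => ?_
  have h1 : LinearMap.smulRightₗ (b.coord l) (f (b l)) ∈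
      (I • ⊤ : Submodule R B).map (LinearMap.smulRightₗ (b.coord l) : B →ₗ[R] (A →ₗ[R] B)) :=
    Submodule.mem_map_of_mem (hf _)
  rw [Submodule.map_smul''] at h1
  exact Submodule.smul_mono le_rfl le_top h1

lemma exists_min_cover (L : Type u) [AddCommGroup L] [Module R L] [Module.Finite R L] :
    ∃ (n : ℕ) (π : (Fin n → R) →ₗ[R] L), Function.Surjective π ∧
      LinearMap.ker π ≤ maximalIdeal R • ⊤ := by
  let b := Module.finBasis (ResidueField R) (TensorProduct R (ResidueField R) L)
  have hs : ∀ i, ∃ x : L, (1 : ResidueField R) ⊗ₜ[R] x = b i := fun i =>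
    TensorProduct.mk_surjective R L (ResidueField R) residue_surjective (b i)
  choose f hf using hs
  have hspan := span_eq_top_of_tmul_eq_basis f b hf
  refine ⟨_, Fintype.linearCombination R f, ?_, ?_⟩
  · rw [← LinearMap.range_eq_top, Fintype.range_linearCombination, hspan]
  · intro v hv
    rw [LinearMap.mem_ker, Fintype.linearCombination_apply] at hv
    have h1 : ∑ i, residue R (v i) • b i = 0 := by
      have := congrArg (fun x => (1 : ResidueField R) ⊗ₜ[R] x) hv
      simp only [TensorProduct.tmul_sum, TensorProduct.tmul_zero, TensorProduct.tmul_smul, hf] at this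
      rw [← this]
      refine Finset.sum_congr rfl fun i _ => ?_
      exact algebraMap_smul (ResidueField R) (v i) (b i)
    have h2 := Fintype.linearIndependent_iff.1 b.linearIndependent _ h1
    have h3 : v = ∑ i, v i • (Pi.single i (1:R) : Fin _ → R) := by
      ext j; simp [Finset.sum_apply, Pi.single_apply]
    rw [h3]
    refine Submodule.sum_mem _ fun i _ => Submodule.smul_mem_smul ?_ trivial
    exact (residue_eq_zero_iff _).1 (h2 i)

lemma lemS [IsNoetherianRing R] (t : ℕ) {n : ℕ}
    (π : (Fin n → R) →ₗ[R] L) (hπ : Function.Surjective π)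
    (hker : LinearMap.ker π ≤ maximalIdeal R • ⊤)
    (hY : ∀ i < t, TE (⊥ : Submonoid R) (ResidueField R) Y i)
    (hL : ∀ j, 1 ≤ j → j ≤ t → TE (⊥ : Submonoid R) L Y j)
    (e : E R (ResidueField R) ((Fin n → R) →ₗ[R] Y) t) :
    ∃ e', post (LinearMap.lcomp R Y π) e' = e := by
  obtain ⟨m, π1, hπ1⟩ := exists_cover (R := R) (LinearMap.ker π)
  refine cov_mid (LinearMap.lcomp R Y π) (resKer π Y).rangeRestrict (lcomp_inj π hπ)
    (exact_rangeRestrict (lcomp_resKer_exact π hπ)) (LinearMap.surjective_rangeRestrict _) e ?_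
  let j : LinearMap.range (resKer π Y) →ₗ[R] ((Fin m → R) →ₗ[R] Y) :=
    LinearMap.lcomp R Y π1 ∘ₗ (LinearMap.range (resKer π Y)).subtype
  have hj : Function.Injective j := (lcomp_inj π1 hπ1).comp (Submodule.subtype_injective _)
  have h0 : post j (post (resKer π Y).rangeRestrict e) = 0 := by
    rw [post_comp]
    apply post_eq_zero_of_mem
    let dd : (Fin m → R) →ₗ[R] (Fin n → R) := (LinearMap.ker π).subtype ∘ₗ π1
    have hd : dd ∈ (maximalIdeal R • ⊤ : Submodule R ((Fin m → R) →ₗ[R] (Fin n → R))) :=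
      hom_mem_smul _ _ fun a => hker (π1 a).2
    let ff : ((Fin m → R) →ₗ[R] (Fin n → R)) →ₗ[R]
        (((Fin n → R) →ₗ[R] Y) →ₗ[R] ((Fin m → R) →ₗ[R] Y)) :=
      (LinearMap.llcomp R (Fin m → R) (Fin n → R) Y).flip
    have : ff dd ∈ Submodule.map ff (maximalIdeal R • ⊤) := Submodule.mem_map_of_mem hd
    rw [Submodule.map_smul''] at this
    exact Submodule.smul_mono le_rfl le_top this
  cases t with
  | zero =>
    obtain ⟨φ, hφ⟩ := hom0.surjective (post (resKer π Y).rangeRestrict e)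
    rw [← hφ] at h0 ⊢
    rw [post_hom0] at h0
    have h1 : j ∘ₗ φ = 0 := (LinearEquiv.map_eq_zero_iff hom0).1 h0
    have : φ = 0 := by
      ext1 x
      apply hj
      simpa using LinearMap.congr_fun h1 x
    rw [this, map_zero]
  | succ t =>
    have htop := resKer_range_top π hπ (hL 1 le_rfl (by omega))
    have hex : Function.Exact j (resKer π1 Y).rangeRestrict := by
      refine exact_rangeRestrict ?_
      intro x
      rw [lcomp_resKer_exact π1 hπ1 x]
      constructor
      · rintro ⟨y, rfl⟩
        exact ⟨⟨y, by rw [htop]; trivial⟩, rfl⟩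
      · rintro ⟨y, rfl⟩
        exact ⟨y.1, rfl⟩
    obtain ⟨δ, h1, h2⟩ := les_cov (X := ResidueField R) j _ hj hex
      (LinearMap.surjective_rangeRestrict _) t
    obtain ⟨e', he'⟩ := (h2 _).1 h0
    have hC := lemC (X := ResidueField R) (Y := Y) (t+1) (LinearMap.ker π) m π1 hπ1 hY (by
      intro j hj hj'
      exact TE.contra_left _ π (Submodule.subtype_injective _) (exact_ker π) hπ
        (by obtain ⟨j, rfl⟩ := Nat.exists_eq_succ_of_ne_zero (by omega : j ≠ 0)
            exact TE_of_projective) (hL (j+1) (by omega) (by omega))) t (by omega)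
    have := subsingleton_of_TE_bot hC
    rw [← he', Subsingleton.elim e' 0, map_zero]

lemma surj_of_ext [Module.Free R A] [Module.Finite R A] [Module.Free R B] [Module.Finite R B]
    {d : ℕ} (hd : Nontrivial (E R (ResidueField R) R d)) (θ : A →ₗ[R] B)
    (hθ : ∀ e : E R (ResidueField R) B d, ∃ e', post θ e' = e) : Function.Surjective θ := by
  by_contra hns
  -- functional
  obtain ⟨lam, hlam, hlt⟩ : ∃ lam : B →ₗ[R] R, (∃ b, lam b = 1) ∧ ∀ a, lam (θ a) ∈ maximalIdeal R := by
    have hne : LinearMap.range θ ⊔ maximalIdeal R • ⊤ ≠ ⊤ := by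
      intro h
      apply hns
      rw [← LinearMap.range_eq_top, eq_top_iff]
      exact Submodule.le_of_le_smul_of_le_jacobson_bot (I := maximalIdeal R)
        (Module.Finite.fg_top) (maximalIdeal_le_jacobson _) h.ge
    let b := Module.Free.chooseBasis R B
    -- base change to the residue field
    let c : B →ₗ[R] (Module.Free.ChooseBasisIndex R B → ResidueField R) :=
      (LinearMap.compLeft (Algebra.linearMap R (ResidueField R)) _) ∘ₗ b.equivFun.toLinearMap
    have hc : Function.Surjective c := by
      intro v
      choose w hw using fun i => residue_surjective (v i)
      refine ⟨b.equivFun.symm w, ?_⟩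
      ext i
      have : b.equivFun (b.equivFun.symm w) i = w i := by rw [LinearEquiv.apply_symm_apply]
      change residue R (b.equivFun (b.equivFun.symm w) i) = v i
      rw [this, hw]
    have hcker : ∀ x, c x = 0 → x ∈ (maximalIdeal R • ⊤ : Submodule R B) := by
      intro x hx
      rw [← b.sum_equivFun x]
      refine Submodule.sum_mem _ fun i _ => Submodule.smul_mem_smul ?_ trivial
      exact (residue_eq_zero_iff _).1 (congrFun hx i)
    let W : Submodule (ResidueField R) (Module.Free.ChooseBasisIndex R B → ResidueField R) :=
      Submodule.span (ResidueField R) (Set.range (c ∘ₗ θ))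
    have hW : W ≠ ⊤ := by
      intro h
      apply hne
      rw [eq_top_iff]
      intro x _
      have hW' : ∀ y ∈ W, ∃ a, c (θ a) = y := by
        intro y hy
        induction hy using Submodule.span_induction with
        | mem x hx => exact hx
        | zero => exact ⟨0, by simp⟩
        | add x y _ _ hx hy =>
          obtain ⟨a, rfl⟩ := hx
          obtain ⟨b, rfl⟩ := hy
          exact ⟨a + b, by simp⟩
        | smul r x _ hx =>
          obtain ⟨a, rfl⟩ := hx
          obtain ⟨r, rfl⟩ := residue_surjective r
          refine ⟨r • a, ?_⟩
          rw [map_smul, map_smul]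
          exact (algebraMap_smul (ResidueField R) r (c (θ a))).symm
      obtain ⟨a, ha⟩ := hW' (c x) (by rw [h]; trivial)
      have := hcker (x - θ a) (by rw [map_sub, ha, sub_self])
      rw [← sub_add_cancel x (θ a), add_comm]
      exact Submodule.add_mem_sup ⟨a, rfl⟩ this
    obtain ⟨φ, hφ, hφW⟩ := Submodule.exists_le_ker_of_lt_top W (lt_top_iff_ne_top.2 hW)
    let φ' : B →ₗ[R] ResidueField R := (φ.restrictScalars R) ∘ₗ c
    obtain ⟨lam, hl⟩ := Module.projective_lifting_property
      (Algebra.linearMap R (ResidueField R)) φ' residue_surjective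
    have hl' : ∀ x, residue R (lam x) = φ (c x) := fun x => LinearMap.congr_fun hl x
    refine ⟨lam, ?_, fun a => ?_⟩
    · obtain ⟨v, hv⟩ : ∃ v, φ v ≠ 0 := by
        by_contra! h
        exact hφ (LinearMap.ext h)
      obtain ⟨x, rfl⟩ := hc v
      rw [← hl', residue_ne_zero_iff_isUnit] at hv
      obtain ⟨w, hw⟩ := hv.exists_left_inv
      exact ⟨w • x, by simpa using hw⟩
    · rw [← residue_eq_zero_iff, hl']
      exact hφW (Submodule.subset_span ⟨a, rfl⟩)
  obtain ⟨b, hb⟩ := hlam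
  obtain ⟨e, he⟩ := exists_ne (0 : E R (ResidueField R) R d)
  apply he
  obtain ⟨e', he'⟩ := hθ (post (LinearMap.toSpanSingleton R B b) e)
  have h1 : post lam (post (LinearMap.toSpanSingleton R B b) e) = e := by
    rw [post_comp]
    have : lam ∘ₗ (LinearMap.toSpanSingleton R B b) = LinearMap.id := by
      ext; simp [hb]
    rw [this, post_id]
  rw [← h1, ← he', post_comp]
  apply post_eq_zero_of_mem
  apply hom_mem_smul
  intro a
  simpa using hlt a

end loc

end Aux

end

noncomputable section

namespace Aux

variable {R : Type u} [CommRing R]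

open IsLocalRing

lemma TE_free_right' {S : Submonoid R} {X A : Type u} [AddCommGroup X] [Module R X]
    [AddCommGroup A] [Module R A] [Module.Free R A] [Module.Finite R A] {i : ℕ}
    (h : TE S X R i) : TE S X A i := by
  by_cases hR : Nontrivial R
  · let b := Module.finBasis R A
    have h1 := TE_free_right (n := Module.finrank R A) h
    exact TE.congr_right (((Pi.basisFun R (Fin _)).constr R).symm.trans b.equivFun.symm) h1
  · rw [not_nontrivial_iff_subsingleton] at hR
    intro e
    exact ⟨1, S.one_mem, by rw [Subsingleton.elim (1 : R) 0, zero_smul]⟩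

lemma step1 [IsLocalRing R] [IsNoetherianRing R] {d : ℕ}
    (hR : ∀ i < d, TE (⊥ : Submonoid R) (ResidueField R) R i)
    (M : Type u) [AddCommGroup M] [Module R M] [Module.Finite R M]
    (hfree : Module.Free R (M →ₗ[R] M))
    (h : ∀ j : ℕ, 1 ≤ j → j ≤ d → TE (⊥ : Submonoid R) M M j) :
    ∀ i < d, TE (⊥ : Submonoid R) (ResidueField R) M i := by
  intro i
  induction i using Nat.strong_induction_on with
  | _ t ih =>
  intro ht
  obtain ⟨n, π, hπ, hker⟩ := exists_min_cover (R := R) M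
  have hs := lemS t π hπ hker (fun i hi => ih i hi (by omega)) (fun j hj hj' => h j hj (by omega))
  have hE := subsingleton_of_TE_bot (TE_free_right' (A := M →ₗ[R] M) (hR t ht))
  rcases Nat.eq_zero_or_pos n with rfl | hn
  · have : Subsingleton M := hπ.subsingleton
    have hM : ModT (⊥ : Submonoid R) M := fun m => ⟨1, Submonoid.one_mem _, Subsingleton.elim _ _⟩
    exact hM.TE_right
  · intro e
    refine ⟨1, Submonoid.one_mem _, ?_⟩
    rw [one_smul]
    let j0 : Fin n := ⟨0, hn⟩
    let f : M →ₗ[R] ((Fin n → R) →ₗ[R] M) := (LinearMap.lcomp R M (LinearMap.proj j0)) ∘ₗ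
        (LinearMap.ringLmapEquivSelf R R M).symm.toLinearMap
    let g : ((Fin n → R) →ₗ[R] M) →ₗ[R] M := LinearMap.applyₗ (Pi.single j0 (1:R) : Fin n → R)
    have hgf : g ∘ₗ f = LinearMap.id := by
      ext x
      simp [g, f]
    obtain ⟨e', he'⟩ := hs (post f e)
    rw [← post_id e, ← hgf, ← post_comp, ← he', Subsingleton.elim e' 0, map_zero, map_zero]

lemma step3 [IsLocalRing R] [IsNoetherianRing R] {d : ℕ}
    (hR : ∀ i < d, TE (⊥ : Submonoid R) (ResidueField R) R i)
    (hd : Nontrivial (E R (ResidueField R) R d))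
    (M : Type u) [AddCommGroup M] [Module R M] [Module.Finite R M]
    (hfree : Module.Free R (M →ₗ[R] M))
    (h : ∀ j : ℕ, 1 ≤ j → j ≤ d → TE (⊥ : Submonoid R) M M j)
    (hrefl : Function.Bijective (Module.Dual.eval R M))
    (hN : ∀ j : ℕ, 1 ≤ j → TE (⊥ : Submonoid R) (Module.Dual R M) R j) :
    Module.Free R M := by
  obtain ⟨n, π, hπ, hker⟩ := exists_min_cover (R := R) M
  obtain ⟨m, ρ, hρ, hkerρ⟩ := exists_min_cover (R := R) (Module.Dual R M)
  rcases Nat.eq_zero_or_pos n with rfl | hn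
  · have : Subsingleton M := hπ.subsingleton
    infer_instance
  have hM := step1 hR M hfree h
  have hs1 := lemS d π hπ hker hM h
  have hs2 := lemS d ρ hρ hkerρ hR (fun j hj _ => hN j hj)
  let ev := LinearEquiv.ofBijective (Module.Dual.eval R M) hrefl
  let κ : M →ₗ[R] ((Fin m → R) →ₗ[R] R) := LinearMap.lcomp R R ρ ∘ₗ Module.Dual.eval R M
  have hκ : Function.Injective κ := (lcomp_inj ρ hρ).comp hrefl.1
  have hκs : ∀ e : E R (ResidueField R) ((Fin m → R) →ₗ[R] R) d, ∃ e', post κ e' = e := by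
    intro e
    obtain ⟨e', he'⟩ := hs2 e
    refine ⟨post ev.symm.toLinearMap e', ?_⟩
    rw [post_comp, ← he']
    refine congrArg (fun ψ => post ψ e') ?_
    ext1 x
    have : Module.Dual.eval R M (ev.symm x) = x := ev.apply_symm_apply x
    simp only [κ, LinearMap.comp_apply, LinearEquiv.coe_coe, this]
  let θ : (M →ₗ[R] M) →ₗ[R] ((Fin n → R) →ₗ[R] ((Fin m → R) →ₗ[R] R)) :=
    LinearMap.compRight R (M := Fin n → R) κ ∘ₗ LinearMap.lcomp R M π
  have hθ : Function.Surjective θ := by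
    refine surj_of_ext (A := M →ₗ[R] M) (B := (Fin n → R) →ₗ[R] ((Fin m → R) →ₗ[R] R)) hd θ fun e => ?_
    obtain ⟨e1, h1⟩ := surj_free_right κ hκs e
    obtain ⟨e2, h2⟩ := hs1 e1
    exact ⟨e2, by rw [← h1, ← h2, post_comp]⟩
  have hκsurj : Function.Surjective κ := by
    intro y
    let j0 : Fin n := ⟨0, hn⟩
    obtain ⟨φ, hφ⟩ := hθ ((LinearMap.toSpanSingleton R _ y) ∘ₗ LinearMap.proj j0)
    refine ⟨φ (π (Pi.single j0 1)), ?_⟩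
    have := LinearMap.congr_fun hφ (Pi.single j0 1)
    simpa [θ] using this
  exact Module.Free.of_equiv (LinearEquiv.ofBijective κ ⟨hκ, hκsurj⟩).symm

end Aux

end

noncomputable section

namespace Aux

open IsLocalRing

section alpha

variable {R : Type u} [CommRing R]
variable {A B C X : Type u} [AddCommGroup A] [Module R A] [AddCommGroup B] [Module R B]
  [AddCommGroup C] [Module R C] [AddCommGroup X] [Module R X]

lemma TE.mono_bot {S : Submonoid R} {i : ℕ} (h : TE (⊥ : Submonoid R) A B i) : TE S A B i :=
  TE_of_subsingleton (subsingleton_of_TE_bot h)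

lemma TE.mono {S T : Submonoid R} (hST : S ≤ T) {i : ℕ} (h : TE S A B i) : TE T A B i := by
  intro e
  obtain ⟨s, hs, hh⟩ := h e
  exact ⟨s, hST hs, hh⟩

lemma ModT.mono {S T : Submonoid R} (hST : S ≤ T) (h : ModT S A) : ModT T A := by
  intro e
  obtain ⟨s, hs, hh⟩ := h e
  exact ⟨s, hST hs, hh⟩

lemma TE_of_sub {S : Submonoid R} {i : ℕ} [Subsingleton A] : TE S A B i :=
  ModT.TE_left (fun h => ⟨1, S.one_mem, Subsingleton.elim _ _⟩)

lemma dim_lt {q q' : Ideal R} [q.IsPrime] [q'.IsPrime] (h : q < q') {e : ℕ}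
    (he : ringKrullDim (R ⧸ q) ≤ e) : ∃ e' : ℕ, e = e' + 1 ∧ ringKrullDim (R ⧸ q') ≤ e' := by
  obtain ⟨x, hx', hx⟩ := SetLike.exists_of_lt h
  have h1 : ringKrullDim (R ⧸ q') + 1 ≤ ringKrullDim (R ⧸ q) := by
    refine ringKrullDim_succ_le_of_surjective (Ideal.Quotient.factor h.le)
      (Ideal.Quotient.factor_surjective h.le) (r := Ideal.Quotient.mk q x) ?_ ?_
    · rw [mem_nonZeroDivisors_iff_ne_zero]
      rwa [Ne, Ideal.Quotient.eq_zero_iff_mem]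
    · rw [Ideal.Quotient.factor_mk, Ideal.Quotient.eq_zero_iff_mem]
      exact hx'
  have h2 := h1.trans he
  have h0 : 0 ≤ ringKrullDim (R ⧸ q') := ringKrullDim_nonneg_of_nontrivial
  cases e with
  | zero =>
    exfalso
    have h3 : (0 : WithBot ℕ∞) + 1 ≤ ((0 : ℕ) : WithBot ℕ∞) := (add_le_add_left h0 1).trans h2
    norm_num at h3
  | succ e' =>
    refine ⟨e', rfl, ?_⟩
    push_cast at h2
    revert h2
    generalize ringKrullDim (R ⧸ q') = z
    intro h2
    induction z with
    | bot => exact bot_le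
    | coe z =>
      have h4 : z + 1 ≤ (e' : ℕ∞) + 1 := by exact_mod_cast h2
      have h5 : z ≤ (e' : ℕ∞) := (ENat.add_le_add_iff_right (by simp)).1 h4
      exact_mod_cast h5

lemma exact_mkQ_range (f : A →ₗ[R] B) : Function.Exact f (LinearMap.range f).mkQ := by
  intro x
  rw [Submodule.mkQ_apply, Submodule.Quotient.mk_eq_zero, LinearMap.mem_range]
  rfl

variable [IsLocalRing R] [IsNoetherianRing R]

lemma TE_bot_of_smul_surj [Module.Finite R A] [Module.Finite R B] {i : ℕ} {x : R}
    (hx : x ∈ maximalIdeal R) (h : ∀ e : E R A B i, ∃ e', x • e' = e) :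
    TE (⊥ : Submonoid R) A B i := by
  have : (⊤ : Submodule R (E R A B i)) = ⊥ := by
    refine Submodule.eq_bot_of_le_smul_of_le_jacobson_bot (Ideal.span {x}) _ ?_ ?_ ?_
    · exact Module.Finite.fg_top
    · intro e _
      obtain ⟨e', rfl⟩ := h e
      exact Submodule.smul_mem_smul (Ideal.mem_span_singleton_self x) trivial
    · rw [Ideal.span_singleton_le_iff_mem]
      exact maximalIdeal_le_jacobson _ hx
  intro e
  refine ⟨1, one_mem _, ?_⟩
  have : e ∈ (⊥ : Submodule R (E R A B i)) := by rw [← this]; trivial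
  simpa using this

lemma alpha {d : ℕ} (Y : Type u) [AddCommGroup Y] [Module R Y] [Module.Finite R Y]
    (hY : ∀ i < d, TE (⊥ : Submonoid R) (ResidueField R) Y i) (e : ℕ) :
    ∀ (q : Ideal R) [q.IsPrime], ringKrullDim (R ⧸ q) ≤ e → ∀ i, i + e < d →
      TE (⊥ : Submonoid R) (R ⧸ q) Y i := by
  induction e using Nat.strong_induction_on with
  | _ e ih =>
  intro q hq he i hi
  by_cases hqm : q = maximalIdeal R
  · subst hqm
    exact hY i (by omega)
  have hlt : q < maximalIdeal R := lt_of_le_of_ne (le_maximalIdeal hq.ne_top) hqm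
  obtain ⟨x, hx, hxq⟩ := SetLike.exists_of_lt hlt
  let f : (R ⧸ q) →ₗ[R] (R ⧸ q) := LinearMap.lsmul R (R ⧸ q) x
  have hf : Function.Injective f := by
    rw [← LinearMap.ker_eq_bot, LinearMap.ker_eq_bot']
    intro y hy
    obtain ⟨y, rfl⟩ := Ideal.Quotient.mk_surjective y
    have h1 : Ideal.Quotient.mk q (x * y) = 0 := by rw [map_mul]; simpa [f, Algebra.smul_def] using hy
    rw [Ideal.Quotient.eq_zero_iff_mem] at h1 ⊢
    exact (hq.mem_or_mem h1).resolve_left hxq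
  obtain ⟨e', rfl, _⟩ := dim_lt hlt he
  have key : ∀ (Z : Type u) [AddCommGroup Z] [Module R Z] (hZ : Module.Finite R Z),
      (∀ r ∈ q ⊔ Ideal.span {x}, ∀ z : Z, r • z = 0) →
      ∀ i, i + e' < d → TE (⊥ : Submonoid R) Z Y i := by
    intro Z _ _ hZ
    induction hZ using IsNoetherianRing.induction_on_isQuotientEquivQuotientPrime R with
    | subsingleton N => intro _ i _; exact TE_of_sub
    | quotient N p' ψ =>
      intro hk i hi
      have hle : q ⊔ Ideal.span {x} ≤ p'.1 := by
        intro r hr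
        have := hk r hr (ψ.symm 1)
        rw [← map_smul, LinearEquiv.map_eq_zero_iff, Algebra.smul_def, mul_one] at this
        exact Ideal.Quotient.eq_zero_iff_mem.1 this
      have hlt' : q < p'.1 := by
        refine lt_of_le_of_ne (le_sup_left.trans hle) ?_
        intro h
        apply hxq
        rw [h]
        exact hle (Ideal.mem_sup_right (Ideal.mem_span_singleton_self x))
      haveI := p'.2
      obtain ⟨e'', h1, h2⟩ := dim_lt hlt' he
      obtain rfl : e' = e'' := by omega
      exact (ih e' (by omega) p'.1 h2 i hi).congr_left ψ.symm
    | exact N₁ N₂ N₃ f g hf hg hfg h1 h3 =>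
      intro hk i hi
      refine TE.contra_mid f g hf hfg hg (h1 ?_ i hi) (h3 ?_ i hi)
      · intro r hr z
        apply hf
        rw [map_smul, hk r hr, map_zero]
      · intro r hr z
        obtain ⟨z, rfl⟩ := hg z
        rw [← map_smul, hk r hr, map_zero]
  have hQ := key ((R ⧸ q) ⧸ LinearMap.range f) inferInstance (by
    intro r hr z
    obtain ⟨y, rfl⟩ := Submodule.mkQ_surjective _ z
    obtain ⟨y, rfl⟩ := Ideal.Quotient.mk_surjective y
    rw [← map_smul, Submodule.mkQ_apply, Submodule.Quotient.mk_eq_zero]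
    obtain ⟨a, ha, b, hb, rfl⟩ := Submodule.mem_sup.1 hr
    obtain ⟨c, rfl⟩ := Ideal.mem_span_singleton'.1 hb
    refine ⟨Ideal.Quotient.mk q (c * y), ?_⟩
    simp only [f, LinearMap.lsmul_apply, Algebra.smul_def]
    change Ideal.Quotient.mk q _ * Ideal.Quotient.mk q _ = Ideal.Quotient.mk q _ * Ideal.Quotient.mk q _
    rw [← map_mul, ← map_mul, Ideal.Quotient.eq]
    have : x * (c * y) - (a + c * x) * y = - (y * a) := by ring
    rw [this]
    exact neg_mem (Ideal.mul_mem_left _ _ ha)) (i+1) (by omega)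
  obtain ⟨δ, h1, h2⟩ := les_contra (X := Y) f _ hf (exact_mkQ_range f) (Submodule.mkQ_surjective _) i
  apply TE_bot_of_smul_surj hx
  intro ε
  haveI := subsingleton_of_TE_bot hQ
  obtain ⟨ε', h⟩ := (h1 ε).1 (Subsingleton.elim _ _)
  refine ⟨ε', ?_⟩
  have h3 := pre_smul x (LinearMap.id : (R ⧸ q) →ₗ[R] _) ε'
  rw [pre_id] at h3
  rw [← h3, ← h]
  rfl

end alpha

end Aux

end

noncomputable section

namespace Aux

open IsLocalRing Pointwise

section beta

variable {R : Type u} [CommRing R]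
variable {A B C X : Type u} [AddCommGroup A] [Module R A] [AddCommGroup B] [Module R B]
  [AddCommGroup C] [Module R C] [AddCommGroup X] [Module R X]

/-- `L` localizes to zero at all primes strictly below `p`. -/
def Small (p : Ideal R) (L : Type u) [AddCommGroup L] [Module R L] : Prop :=
  ∀ (q : Ideal R) [q.IsPrime], q < p → ModT q.primeCompl L

lemma Small.of_injective {p : Ideal R} (f : A →ₗ[R] B) (hf : Function.Injective f)
    (h : Small p B) : Small p A := fun q _ hq => (h q hq).of_injective f hf

lemma Small.of_surjective {p : Ideal R} (f : A →ₗ[R] B) (hf : Function.Surjective f)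
    (h : Small p A) : Small p B := fun q _ hq => (h q hq).of_surjective f hf

lemma gamma [IsNoetherianRing R] {p : Ideal R} [hp : p.IsPrime] (H : Type u) [AddCommGroup H]
    [Module R H] [Module.Finite R H]
    (hs : Small p H) (h : TE p.primeCompl (R ⧸ p) H 0) : ModT p.primeCompl H := by
  by_contra hcon
  have hann : Module.annihilator R H ≤ p := by
    intro r hr
    by_contra hrp
    exact hcon fun x => ⟨r, hrp, Module.mem_annihilator.1 hr x⟩
  have hmin : p ∈ (Module.annihilator R H).minimalPrimes := by
    refine ⟨⟨hp, hann⟩, ?_⟩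
    rintro q ⟨hq, hqa⟩ hqp
    by_contra hne
    have hlt : q < p := lt_of_le_not_ge hqp hne
    obtain ⟨s, hs1, hs2⟩ := (hs q hlt).exists_smul
    exact hs1 (hqa (Module.mem_annihilator.2 hs2))
  obtain ⟨_, f, hf⟩ := (isAssociatedPrime_iff_exists_injective_linearMap p H).1
    (Module.associatedPrimes.minimalPrimes_annihilator_subset_associatedPrimes R H hmin)
  obtain ⟨s, hs1, hs2⟩ := TE_zero_iff.1 h f
  apply hs1
  have h1 : f (s • 1) = 0 := by
    rw [map_smul]
    exact LinearMap.congr_fun hs2 1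
  rw [map_eq_zero_iff f hf, Algebra.smul_def, mul_one] at h1
  exact Ideal.Quotient.eq_zero_iff_mem.1 h1

lemma TE_regular {S : Submonoid R} (rs : List R) : ∀ (Z : Type u) [AddCommGroup Z] [Module R Z],
    RingTheory.Sequence.IsWeaklyRegular Z rs → (∀ i ≤ rs.length, TE S X Z i) →
    TE S X (Z ⧸ (Ideal.ofList rs • ⊤ : Submodule R Z)) 0 := by
  induction rs with
  | nil =>
    intro Z _ _ _ h
    refine (h 0 le_rfl).congr_right (Submodule.quotEquivOfEqBot _ ?_).symm
    simp
  | cons x rs ih =>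
    intro Z _ _ hreg h
    rw [RingTheory.Sequence.isWeaklyRegular_cons_iff] at hreg
    refine (ih (QuotSMulTop x Z) hreg.2 ?_).congr_right
      (Submodule.quotOfListConsSMulTopEquivQuotSMulTopInner Z x rs).symm
    intro i hi
    refine TE.cov_right (LinearMap.lsmul R Z x) (Submodule.mkQ (x • ⊤ : Submodule R Z))
      hreg.1 ?_ (Submodule.mkQ_surjective _) (h i (by simp; omega)) (h (i+1) (by simpa using hi))
    intro y
    rw [Submodule.mkQ_apply, Submodule.Quotient.mk_eq_zero, Submodule.mem_smul_pointwise_iff_exists]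
    simp

variable [IsLocalRing R] [IsNoetherianRing R]

lemma beta0_seq {d : ℕ} (hR : ∀ i < d, TE (⊥ : Submonoid R) (ResidueField R) R i)
    (p : Ideal R) [hp : p.IsPrime] {c e : ℕ}
    (he : ringKrullDim (R ⧸ p) = e) (hce : c + e = d) :
    ∃ rs : List R, rs.length = c ∧ (∀ r ∈ rs, r ∈ p) ∧ RingTheory.Sequence.IsRegular R rs := by
  have h1 : p • (⊤ : Submodule R (ModuleCat.of R R)) < ⊤ := by
    rw [lt_top_iff_ne_top]
    intro h
    have h2 : (1 : R) ∈ p • (⊤ : Submodule R R) := by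
      change (1 : R) ∈ p • (⊤ : Submodule R (ModuleCat.of R R))
      rw [h]
      exact Submodule.mem_top
    exact hp.ne_top ((Ideal.eq_top_iff_one _).2
      (Submodule.smul_le.2 (fun r hr n _ => Ideal.mul_mem_right _ _ hr) h2))
  have h2 : ∀ i < c, Subsingleton (Abelian.Ext (ModuleCat.of R (R ⧸ p)) (ModuleCat.of R R) i) :=
    fun i hi => subsingleton_of_TE_bot (alpha R hR e p he.le i (by omega))
  have h3' : Module.support R (R ⧸ p) = PrimeSpectrum.zeroLocus (p : Set R) := by
    rw [Module.support_eq_zeroLocus, Ideal.annihilator_quotient]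
  have h3 : Module.support R (ModuleCat.of R (R ⧸ p)) = PrimeSpectrum.zeroLocus (p : Set R) := by
    rw [← h3']
  exact ModuleCat.exists_isRegular_of_exists_subsingleton_ext p c
    (ModuleCat.of R R) h1 (ModuleCat.of R (R ⧸ p)) h3 h2

lemma dim_aux {z : WithBot ℕ∞} {c d e : ℕ} (hd : z + c = d) (hce : c + e = d) : z ≤ e := by
  induction z with
  | bot => exact bot_le
  | coe z =>
    have h4 : z + c = (d : ℕ∞) := by exact_mod_cast hd
    have h5 : z + c ≤ (e : ℕ∞) + c := by
      rw [h4, ← hce]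
      push_cast
      rw [add_comm]
    have h6 : z ≤ (e : ℕ∞) := (ENat.add_le_add_iff_right (by simp)).1 h5
    exact_mod_cast h6

lemma beta0_small (J p : Ideal R) {c d e : ℕ} (hd : ringKrullDim (R ⧸ J) + c = d)
    [hp : p.IsPrime] (he : ringKrullDim (R ⧸ p) = e) (hce : c + e = d) :
    Small p (R ⧸ (J • ⊤ : Submodule R R)) := by
  intro q hq hqp
  have hnle : ¬ J ≤ q := by
    intro hh
    have h1 : ringKrullDim (R ⧸ q) ≤ ringKrullDim (R ⧸ J) :=
      ringKrullDim_le_of_surjective (Ideal.Quotient.factor hh) (Ideal.Quotient.factor_surjective hh)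
    have h2 : ringKrullDim (R ⧸ J) ≤ e := dim_aux hd hce
    obtain ⟨e', h3, h4⟩ := dim_lt hqp (h1.trans h2)
    rw [he] at h4
    have : e ≤ e' := by exact_mod_cast h4
    omega
  obtain ⟨r, hr, hrq⟩ := SetLike.not_le_iff_exists.1 hnle
  intro z
  refine ⟨r, hrq, ?_⟩
  obtain ⟨y, rfl⟩ := Submodule.mkQ_surjective _ z
  rw [← map_smul, Submodule.mkQ_apply, Submodule.Quotient.mk_eq_zero]
  exact Submodule.smul_mem_smul hr trivial

lemma beta0 {d : ℕ} (hR : ∀ i < d, TE (⊥ : Submonoid R) (ResidueField R) R i)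
    (hdim : ringKrullDim R = d) (p : Ideal R) [hp : p.IsPrime] {c e : ℕ}
    (he : ringKrullDim (R ⧸ p) = e) (hce : c + e = d) : ¬ TE p.primeCompl (R ⧸ p) R c := by
  intro hT
  obtain ⟨rs, hlen, hmem, hreg⟩ := beta0_seq hR p he hce
  have hle : Ideal.ofList rs ≤ p := by
    rw [Ideal.ofList, Ideal.span_le]
    exact hmem
  have hd := ringKrullDim_add_length_eq_ringKrullDim_of_isRegular rs hreg
  rw [hlen, hdim] at hd
  have hTE := TE_regular (S := p.primeCompl) (X := R ⧸ p) rs R hreg.toIsWeaklyRegular (by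
    intro i hi
    rw [hlen] at hi
    rcases hi.lt_or_eq with hi | hi
    · exact (alpha R hR e p he.le i (by omega)).mono_bot
    · rw [hi]; exact hT)
  have hsm := beta0_small (Ideal.ofList rs) p hd he hce
  obtain ⟨s, hs, hs'⟩ := gamma _ hsm hTE (Submodule.mkQ _ 1)
  rw [← map_smul, Submodule.mkQ_apply, Submodule.Quotient.mk_eq_zero] at hs'
  apply hs
  apply hle
  have h5 : (s • 1 : R) ∈ Ideal.ofList rs :=
    Submodule.smul_le.2 (fun r hr n _ => Ideal.mul_mem_right _ _ hr) hs'
  rwa [smul_eq_mul, mul_one] at h5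

lemma not_small_quot {p q : Ideal R} [q.IsPrime] (hqp : q < p) : ¬ Small p (R ⧸ q) := by
  intro h
  obtain ⟨s, hs, h'⟩ := h q hqp 1
  rw [Algebra.smul_def, mul_one] at h'
  exact hs (Ideal.Quotient.eq_zero_iff_mem.1 h')

lemma modT_quot {p q : Ideal R} [p.IsPrime] (hqp : ¬ q ≤ p) : ModT p.primeCompl (R ⧸ q) := by
  obtain ⟨r, hr, hrq⟩ := SetLike.not_le_iff_exists.1 hqp
  intro z
  refine ⟨r, hrq, ?_⟩
  rw [Algebra.smul_def]
  have : algebraMap R (R ⧸ q) r = 0 := Ideal.Quotient.eq_zero_iff_mem.2 hr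
  rw [this, zero_mul]

lemma beta1 {d : ℕ} (Y : Type u) [AddCommGroup Y] [Module R Y] [Module.Finite R Y]
    (hY : ∀ i < d, TE (⊥ : Submonoid R) (ResidueField R) Y i)
    (p : Ideal R) [hp : p.IsPrime] {c e : ℕ}
    (he : ringKrullDim (R ⧸ p) = e) (hce : c + e = d) (L : Type u) [AddCommGroup L]
    [Module R L] [hL : Module.Finite R L] (hs : Small p L) :
    ∀ i < c, TE p.primeCompl L Y i := by
  induction hL using IsNoetherianRing.induction_on_isQuotientEquivQuotientPrime R with
  | subsingleton N => intro i _; exact TE_of_sub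
  | quotient N q ψ =>
    intro i hi
    have := q.2
    have hs' : Small p (R ⧸ q.1) := hs.of_surjective ψ.toLinearMap ψ.surjective
    refine TE.congr_left ψ.symm ?_
    by_cases h1 : q.1 ≤ p
    · rcases h1.lt_or_eq with h2 | h2
      · exact absurd hs' (not_small_quot h2)
      · rw [h2]
        exact (alpha Y hY e p he.le i (by omega)).mono_bot
    · exact (modT_quot h1).TE_left
  | exact N₁ N₂ N₃ f g hf hg hfg h1 h3 =>
    intro i hi
    exact TE.contra_mid f g hf hfg hg (h1 (hs.of_injective f hf) i hi)
      (h3 (hs.of_surjective g hg) i hi)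

lemma beta2 {d : ℕ} (hR : ∀ i < d, TE (⊥ : Submonoid R) (ResidueField R) R i)
    (hdim : ringKrullDim R = d) (p : Ideal R) [hp : p.IsPrime] {c e : ℕ}
    (he : ringKrullDim (R ⧸ p) = e) (hce : c + e = d) (L : Type u) [AddCommGroup L]
    [Module R L] [hL : Module.Finite R L] (hs : Small p L) :
    TE p.primeCompl L R c → ModT p.primeCompl L := by
  induction hL using IsNoetherianRing.induction_on_isQuotientEquivQuotientPrime R with
  | subsingleton N => intro _ x; exact ⟨1, one_mem _, Subsingleton.elim _ _⟩
  | quotient N q ψ =>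
    intro hT
    have := q.2
    have hs' : Small p (R ⧸ q.1) := hs.of_surjective ψ.toLinearMap ψ.surjective
    refine ModT.of_injective ψ.toLinearMap ψ.injective ?_
    by_cases h1 : q.1 ≤ p
    · rcases h1.lt_or_eq with h2 | h2
      · exact absurd hs' (not_small_quot h2)
      · exfalso
        have hT' := hT.congr_left ψ
        rw [h2] at hT'
        exact beta0 hR hdim p he hce hT'
    · exact modT_quot h1
  | exact N₁ N₂ N₃ f g hf hg hfg h1 h3 =>
    intro hT
    have hs1 := hs.of_injective f hf
    have hs3 := hs.of_surjective g hg
    have hT3 : TE p.primeCompl N₃ R c := by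
      cases c with
      | zero => exact hT.contra_right0 g hg
      | succ c =>
        exact TE.contra_right f g hf hfg hg (beta1 R hR p he hce N₁ hs1 c (by omega)) hT
    have hm3 := h3 hs3 hT3
    have hT1 : TE p.primeCompl N₁ R c := TE.contra_left f g hf hfg hg hT hm3.TE_left
    exact ModT.mid f g (fun x hx => (hfg x).1 hx) (h1 hs1 hT1) hm3

end beta

end Aux

end

noncomputable section

namespace Aux

open IsLocalRing

section ext1

variable {R : Type u} [CommRing R]
variable {A B C X L F : Type u} [AddCommGroup A] [Module R A] [AddCommGroup B] [Module R B]
  [AddCommGroup C] [Module R C] [AddCommGroup X] [Module R X] [AddCommGroup L] [Module R L]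
  [AddCommGroup F] [Module R F] {S : Submonoid R}

lemma TE1_of_extend (f : A →ₗ[R] B) (g : B →ₗ[R] C) (hf : Function.Injective f)
    (hfg : Function.Exact f g) (hg : Function.Surjective g) (hB : TE S B X 1)
    (hext : ∀ φ : A →ₗ[R] X, ∃ s ∈ S, ∃ ψ : B →ₗ[R] X, ψ ∘ₗ f = s • φ) : TE S C X 1 := by
  intro e
  obtain ⟨δ, h1, h2⟩ := les_contra (X := X) f g hf hfg hg 0
  obtain ⟨s, hs, hh⟩ := hB (pre g e)
  rw [← map_smul, h2] at hh
  obtain ⟨e', he'⟩ := hh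
  obtain ⟨φ, rfl⟩ := hom0.surjective e'
  obtain ⟨t, ht, ψ, hψ⟩ := hext φ
  refine ⟨t * s, S.mul_mem ht hs, ?_⟩
  rw [mul_smul, ← he', ← map_smul, h1]
  refine ⟨hom0 ψ, ?_⟩
  rw [pre_hom0, hψ, map_smul]

lemma modT_coker_of_TE1 (π : F →ₗ[R] L) (hπ : Function.Surjective π) (h : TE S L R 1) :
    ModT S ((LinearMap.ker π →ₗ[R] R) ⧸ LinearMap.range (resKer π R)) := by
  intro z
  obtain ⟨φ, rfl⟩ := Submodule.mkQ_surjective _ z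
  obtain ⟨s, hs, ψ, hψ⟩ := extend_of_TE _ π (Submodule.subtype_injective _) (exact_ker π) hπ h φ
  refine ⟨s, hs, ?_⟩
  rw [← map_smul, Submodule.mkQ_apply, Submodule.Quotient.mk_eq_zero]
  exact ⟨ψ, hψ⟩

lemma TE1_of_modT_coker (π : F →ₗ[R] L) (hπ : Function.Surjective π) (hF : TE S F R 1)
    (h : ModT S ((LinearMap.ker π →ₗ[R] R) ⧸ LinearMap.range (resKer π R))) : TE S L R 1 := by
  refine TE1_of_extend _ π (Submodule.subtype_injective _) (exact_ker π) hπ hF ?_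
  intro φ
  obtain ⟨s, hs, hh⟩ := h (Submodule.mkQ _ φ)
  rw [← map_smul, Submodule.mkQ_apply, Submodule.Quotient.mk_eq_zero] at hh
  obtain ⟨ψ, hψ⟩ := hh
  exact ⟨s, hs, ψ, hψ⟩

lemma exact_sub_mkQ (B : Submodule R A) : Function.Exact B.subtype B.mkQ := by
  intro x
  simp

variable [IsNoetherianRing R]

lemma finite_coker [Module.Finite R F] (π : F →ₗ[R] L) :
    Module.Finite R ((LinearMap.ker π →ₗ[R] R) ⧸ LinearMap.range (resKer π R)) :=
  inferInstance

lemma lower {p : Ideal R} [hp : p.IsPrime] {c : ℕ}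
    (hRp : ∀ i < c, TE p.primeCompl (R ⧸ p) R i) (t : ℕ) :
    ∀ (N : Type u) [AddCommGroup N] [Module R N] [Module.Finite R N]
      (B : Submodule R (N →ₗ[R] R)),
      t ≤ c → (∀ i < t, TE p.primeCompl (R ⧸ p) B i) → Small p ((N →ₗ[R] R) ⧸ B) →
      (∀ (q : Ideal R) [q.IsPrime], q < p → ∀ i, 1 ≤ i → TE q.primeCompl N R i) →
      (2 ≤ t → ModT p.primeCompl ((N →ₗ[R] R) ⧸ B)) ∧
        ∀ i, 1 ≤ i → i + 2 ≤ t → TE p.primeCompl N R i := by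
  induction t with
  | zero => intros; exact ⟨by omega, by omega⟩
  | succ t ih =>
    intro N _ _ _ B htc hB hsm hq
    rcases Nat.eq_zero_or_pos t with rfl | ht
    · exact ⟨by omega, by omega⟩
    obtain ⟨n, π, hπ⟩ := exists_cover (R := R) N
    have hF : ∀ i < c, TE p.primeCompl (R ⧸ p) ((Fin n → R) →ₗ[R] R) i :=
      fun i hi => TE_free_right (hRp i hi)
    have h0 : TE p.primeCompl (R ⧸ p) (N →ₗ[R] R) 0 :=
      TE.cov_left0 (LinearMap.lcomp R R π) (lcomp_inj π hπ) (hF 0 (by omega))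
    have hH0 : TE p.primeCompl (R ⧸ p) ((N →ₗ[R] R) ⧸ B) 0 :=
      TE.cov_right B.subtype B.mkQ B.subtype_injective (exact_sub_mkQ B) B.mkQ_surjective h0
        (hB 1 (by omega))
    have hH := gamma _ hsm hH0
    have hN : ∀ i < t + 1, TE p.primeCompl (R ⧸ p) (N →ₗ[R] R) i := fun i hi =>
      TE.cov_mid B.subtype B.mkQ B.subtype_injective (exact_sub_mkQ B) B.mkQ_surjective
        (hB i hi) hH.TE_right
    have hB1 : ∀ i < t, TE p.primeCompl (R ⧸ p) (LinearMap.range (resKer π R)) i := fun i hi =>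
      TE.cov_right (LinearMap.lcomp R R π) (resKer π R).rangeRestrict (lcomp_inj π hπ)
        (exact_rangeRestrict (lcomp_resKer_exact π hπ)) (LinearMap.surjective_rangeRestrict _)
        (hF i (by omega)) (hN (i+1) (by omega))
    obtain ⟨ih1, ih2⟩ := ih (LinearMap.ker π) (LinearMap.range (resKer π R)) (by omega) hB1
      (fun q _ hqp => modT_coker_of_TE1 π hπ (hq q hqp 1 le_rfl))
      (fun q _ hqp i hi => by
        obtain ⟨i, rfl⟩ := Nat.exists_eq_succ_of_ne_zero (by omega : i ≠ 0)
        exact TE.contra_left _ π (Submodule.subtype_injective _) (exact_ker π) hπ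
          TE_of_projective (hq q hqp (i+1+1) (by omega)))
    refine ⟨fun _ => hH, ?_⟩
    intro i hi hit
    rcases hi.eq_or_lt with rfl | hi
    · exact TE1_of_modT_coker π hπ TE_of_projective (ih1 (by omega))
    · obtain ⟨i, rfl⟩ := Nat.exists_eq_succ_of_ne_zero (by omega : i ≠ 0)
      exact TE.contra_right _ π (Submodule.subtype_injective _) (exact_ker π) hπ
        (ih2 i (by omega) (by omega)) TE_of_projective

end ext1

section upper

variable {R : Type u} [CommRing R] [IsLocalRing R] [IsNoetherianRing R]

/-- extension property of functionals on the range -/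
lemma propE {N Q : Type u} [AddCommGroup N] [Module R N] [AddCommGroup Q] [Module R Q]
    (β : Q →ₗ[R] (N →ₗ[R] R))
    (D2 : ∀ f : Q →ₗ[R] R, (∀ q, β q = 0 → f q = 0) → ∃ n, ∀ q, f q = β q n)
    (f : LinearMap.range β →ₗ[R] R) : ∃ n : N, ∀ b, f b = b.1 n := by
  obtain ⟨n, hn⟩ := D2 (f ∘ₗ β.rangeRestrict) (by
    intro q hq
    have : β.rangeRestrict q = 0 := Subtype.ext hq
    simp [this])
  refine ⟨n, ?_⟩
  rintro ⟨_, q, rfl⟩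
  exact hn q

lemma Hmod {d : ℕ} (hR : ∀ i < d, TE (⊥ : Submonoid R) (ResidueField R) R i)
    (hdim : ringKrullDim R = d) (p : Ideal R) [hp : p.IsPrime] {c e : ℕ}
    (he : ringKrullDim (R ⧸ p) = e) (hce : c + e = d)
    (N Q : Type u) [AddCommGroup N] [Module R N] [Module.Finite R N] [AddCommGroup Q] [Module R Q]
    (β : Q →ₗ[R] (N →ₗ[R] R)) (b : ℕ)
    (D1 : ∀ n, (∀ q, β q n = 0) → n = 0)
    (D2 : ∀ f : Q →ₗ[R] R, (∀ q, β q = 0 → f q = 0) → ∃ n, ∀ q, f q = β q n)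
    (hsm : Small p ((N →ₗ[R] R) ⧸ LinearMap.range β))
    (hB : ∀ j, 1 ≤ j → j ≤ b → j + 1 ≤ c → TE p.primeCompl (LinearMap.range β) R j)
    (hl1 : b + 2 ≤ c → ModT p.primeCompl ((N →ₗ[R] R) ⧸ LinearMap.range β))
    (hN : ∀ j, 1 ≤ j → TE p.primeCompl (N →ₗ[R] R) R j)
    (U3 : ∀ f : (N →ₗ[R] R) →ₗ[R] R, ∃ s ∈ p.primeCompl, ∃ n, ∀ φ, s • f φ = φ n) :
    ModT p.primeCompl ((N →ₗ[R] R) ⧸ LinearMap.range β) := by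
  by_cases hb : b + 2 ≤ c
  · exact hl1 hb
  refine beta2 hR hdim p he hce _ hsm ?_
  match c, hb, hB with
  | 0, _, _ =>
    rw [TE_zero_iff]
    intro f
    obtain ⟨s, hs, n, hn⟩ := U3 (f ∘ₗ Submodule.mkQ _)
    refine ⟨s, hs, ?_⟩
    have hn0 : n = 0 := by
      apply D1
      intro q
      rw [← hn]
      have : (LinearMap.range β).mkQ (β q) = 0 := by
        rw [Submodule.mkQ_apply, Submodule.Quotient.mk_eq_zero]
        exact ⟨q, rfl⟩
      simp only [LinearMap.comp_apply, this, map_zero, smul_zero]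
    apply LinearMap.ext
    intro z
    obtain ⟨φ, rfl⟩ := Submodule.mkQ_surjective _ z
    have := hn φ
    rw [hn0, map_zero] at this
    exact this
  | 1, _, _ =>
    refine TE1_of_extend _ _ (Submodule.subtype_injective _) (exact_sub_mkQ _)
      (Submodule.mkQ_surjective _) (hN 1 le_rfl) ?_
    intro φ
    obtain ⟨n, hn⟩ := propE β D2 φ
    refine ⟨1, one_mem _, LinearMap.applyₗ n, ?_⟩
    ext b
    simp [hn]
  | c + 2, hb, hB =>
    exact TE.contra_right _ _ (Submodule.subtype_injective _) (exact_sub_mkQ _)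
      (Submodule.mkQ_surjective _) (hB (c+1) (by omega) (by omega) (by omega)) (hN _ (by omega))

lemma TR_TE {S : Submonoid R} {G : Type u} [AddCommGroup G] [Module R G]
    (h : TotallyReflexive R G) (i : ℕ) (hi : 1 ≤ i) :
    TE S G R i ∧ TE S (G →ₗ[R] R) R i :=
  ⟨TE_of_subsingleton ((bridge _ _ _).1 (h.2 i hi).1),
    TE_of_subsingleton ((bridge _ _ _).1 (h.2 i hi).2)⟩

lemma upper {d : ℕ} (hR : ∀ i < d, TE (⊥ : Submonoid R) (ResidueField R) R i)
    (hdim : ringKrullDim R = d) (p : Ideal R) [hp : p.IsPrime] {c e : ℕ}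
    (he : ringKrullDim (R ⧸ p) = e) (hce : c + e = d) (n : ℕ) :
    ∀ (N Q : Type u) [AddCommGroup N] [Module R N] [Module.Finite R N] [AddCommGroup Q]
    [Module R Q] (β : Q →ₗ[R] (N →ₗ[R] R)) (b : ℕ)
    (_ : GdimLE R n (ModuleCat.of R N))
    (_ : ∀ n, (∀ q, β q n = 0) → n = 0)
    (_ : ∀ f : Q →ₗ[R] R, (∀ q, β q = 0 → f q = 0) → ∃ n, ∀ q, f q = β q n)
    (_ : Small p ((N →ₗ[R] R) ⧸ LinearMap.range β))
    (_ : ∀ (q : Ideal R) [q.IsPrime], q < p → ∀ i, 1 ≤ i → TE q.primeCompl N R i)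
    (_ : ∀ j, 1 ≤ j → j ≤ b → j + 1 ≤ c → TE p.primeCompl (LinearMap.range β) R j)
    (_ : b + 2 ≤ c → ModT p.primeCompl ((N →ₗ[R] R) ⧸ LinearMap.range β))
    (_ : ∀ i, 1 ≤ i → i + b + 2 ≤ c → TE p.primeCompl N R i),
    ModT p.primeCompl ((N →ₗ[R] R) ⧸ LinearMap.range β) ∧
    (∀ j, 1 ≤ j → TE p.primeCompl N R j) ∧
    (∀ j, 1 ≤ j → TE p.primeCompl (N →ₗ[R] R) R j) := by
  induction n with
  | zero =>
    intro N Q _ _ _ _ _ β b hG D1 D2 hsm hq hB hl1 hl2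
    have hTR : TotallyReflexive R N := hG
    refine ⟨Hmod hR hdim p he hce N Q β b D1 D2 hsm hB hl1 (fun j hj => (TR_TE hTR j hj).2) ?_,
      fun j hj => (TR_TE hTR j hj).1, fun j hj => (TR_TE hTR j hj).2⟩
    intro f
    obtain ⟨n, hn⟩ := hTR.1.2 f
    refine ⟨1, one_mem _, n, fun φ => ?_⟩
    rw [one_smul, ← hn]
    rfl
  | succ n ih =>
    intro N Q _ _ _ _ _ β b hG D1 D2 hsm hq hB hl1 hl2
    obtain ⟨G, g, hGf, hTR, hg, hker⟩ := hG
    have hsubI := Submodule.subtype_injective (LinearMap.ker g)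
    have hex := exact_ker g
    have hinj := lcomp_inj (Y := R) g hg
    have hex' := exact_rangeRestrict (lcomp_resKer_exact (Y := R) g hg)
    have hrs := LinearMap.surjective_rangeRestrict (resKer g R)
    have hBi := Submodule.subtype_injective (LinearMap.range β)
    have hBe := exact_sub_mkQ (LinearMap.range β)
    have hBs := Submodule.mkQ_surjective (LinearMap.range β)
    have hTEH : ∀ j < c, TE p.primeCompl ((N →ₗ[R] R) ⧸ LinearMap.range β) R j :=
      beta1 R hR p he hce _ hsm
    have hB1 : ∀ j, 1 ≤ j → j ≤ b + 1 → j + 1 ≤ c →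
        TE p.primeCompl (LinearMap.range (resKer g R)) R j := by
      intro j hj1 hjb hjc
      rcases hj1.eq_or_lt with rfl | hj1
      · refine TE1_of_extend _ _ hinj hex' hrs (TR_TE hTR 1 le_rfl).2 ?_
        intro φ
        obtain ⟨n, hn⟩ := propE β D2 (φ ∘ₗ Submodule.subtype _)
        have hle : LinearMap.range β ≤ LinearMap.ker (φ - LinearMap.applyₗ n) := by
          intro x hx
          have := hn ⟨x, hx⟩
          rw [LinearMap.mem_ker, LinearMap.sub_apply, sub_eq_zero]
          exact this
        obtain ⟨s, hs, hs'⟩ := TE_zero_iff.1 (hTEH 0 (by omega)) (Submodule.liftQ _ _ hle)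
        obtain ⟨g0, rfl⟩ := hg n
        refine ⟨s, hs, s • LinearMap.applyₗ g0, ?_⟩
        apply LinearMap.ext
        intro x
        have h1 := LinearMap.congr_fun hs' (Submodule.mkQ _ x)
        have h2 : s • (φ x - x (g g0)) = 0 := h1
        rw [smul_sub, sub_eq_zero] at h2
        exact h2.symm
      · obtain ⟨j, rfl⟩ := Nat.exists_eq_succ_of_ne_zero (by omega : j ≠ 0)
        refine TE.contra_right _ _ hinj hex' hrs ?_ (TR_TE hTR _ (by omega)).2
        exact TE.contra_mid _ _ hBi hBe hBs (hB j (by omega) (by omega) (by omega))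
          (hTEH j (by omega))
    obtain ⟨i1, i2, i3⟩ := ih (LinearMap.ker g) (G →ₗ[R] R) (resKer g R) (b+1) hker
      (by
        intro x hx
        apply Subtype.ext
        apply hTR.1.1
        apply LinearMap.ext
        intro φ
        simpa using hx φ)
      (by
        intro f hf
        obtain ⟨g0, hg0⟩ := hTR.1.2 f
        have hmem : g g0 = 0 := by
          apply D1
          intro q
          have h1 := hf (LinearMap.lcomp R R g (β q)) ((lcomp_resKer_exact (Y := R) g hg _).2 ⟨_, rfl⟩)
          rw [← hg0] at h1
          exact h1
        refine ⟨⟨g0, hmem⟩, fun q => ?_⟩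
        rw [← hg0]
        rfl)
      (fun q _ hqp => modT_coker_of_TE1 g hg (hq q hqp 1 le_rfl))
      (fun q _ hqp i hi => TE.contra_left _ _ hsubI hex hg (TR_TE hTR i hi).1
        (hq q hqp (i+1) (by omega)))
      hB1
      (fun hc => modT_coker_of_TE1 g hg (hl2 1 le_rfl (by omega)))
      (fun i hi hc => TE.contra_left _ _ hsubI hex hg (TR_TE hTR i hi).1
        (hl2 (i+1) (by omega) (by omega)))
    have hfin2 : Module.Finite R ((LinearMap.ker g →ₗ[R] R) ⧸ LinearMap.range (resKer g R)) :=
      finite_coker g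
    have hNR : ∀ j, 1 ≤ j → TE p.primeCompl N R j := by
      intro j hj
      rcases hj.eq_or_lt with rfl | hj
      · exact TE1_of_modT_coker g hg (TR_TE hTR 1 le_rfl).1 i1
      · obtain ⟨j, rfl⟩ := Nat.exists_eq_succ_of_ne_zero (by omega : j ≠ 0)
        exact TE.contra_right _ _ hsubI hex hg (i2 j (by omega)) (TR_TE hTR _ (by omega)).1
    have hB1' : ∀ j, 1 ≤ j → TE p.primeCompl (LinearMap.range (resKer g R)) R j := fun j hj =>
      TE.contra_left _ _ (Submodule.subtype_injective _) (exact_sub_mkQ _)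
        (Submodule.mkQ_surjective _) (i3 j hj) i1.TE_left
    have hND : ∀ j, 1 ≤ j → TE p.primeCompl (N →ₗ[R] R) R j := fun j hj =>
      TE.contra_left _ _ hinj hex' hrs (TR_TE hTR j hj).2 (hB1' (j+1) (by omega))
    refine ⟨Hmod hR hdim p he hce N Q β b D1 D2 hsm hB hl1 hND ?_, hNR, hND⟩
    intro f
    obtain ⟨s, hs, ψ, hψ⟩ := extend_of_TE _ _ hinj hex' hrs (hB1' 1 le_rfl) f
    obtain ⟨g0, hg0⟩ := hTR.1.2 ψ
    refine ⟨s, hs, g g0, fun φ => ?_⟩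
    have h1 := LinearMap.congr_fun hψ φ
    rw [← hg0] at h1
    exact h1.symm

end upper

end Aux

end

noncomputable section

namespace Aux

open IsLocalRing

section step2

variable {R : Type u} [CommRing R] [IsLocalRing R] [IsNoetherianRing R]

lemma exists_dim {d : ℕ} (hdim : ringKrullDim R = d) (q : Ideal R) [hq : q.IsPrime] :
    ∃ c e : ℕ, ringKrullDim (R ⧸ q) = e ∧ c + e = d := by
  have h1 : ringKrullDim (R ⧸ q) ≤ d := hdim ▸ ringKrullDim_quotient_le q
  have h0 : 0 ≤ ringKrullDim (R ⧸ q) := ringKrullDim_nonneg_of_nontrivial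
  revert h0 h1
  generalize ringKrullDim (R ⧸ q) = z
  intro h1 h0
  induction z with
  | bot => simp at h0
  | coe z =>
    have h2 : z ≤ (d : ℕ∞) := by exact_mod_cast h1
    obtain ⟨e, rfl⟩ := ENat.ne_top_iff_exists.1 (ne_top_of_le_ne_top (ENat.coe_ne_top d) h2)
    have h3 : e ≤ d := by exact_mod_cast h2
    exact ⟨d - e, e, rfl, by omega⟩

lemma step2 {d : ℕ} (hR : ∀ i < d, TE (⊥ : Submonoid R) (ResidueField R) R i)
    (hdim : ringKrullDim R = d) (M : Type u) [AddCommGroup M] [Module R M] [Module.Finite R M]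
    (hM : ∀ i < d, TE (⊥ : Submonoid R) (ResidueField R) M i) {n : ℕ}
    (hG : GdimLE R n (ModuleCat.of R (M →ₗ[R] R))) (β : M →ₗ[R] ((M →ₗ[R] R) →ₗ[R] R))
    (hβ : ∀ m f, β m f = f m) (c : ℕ) :
    ∀ (p : Ideal R) [p.IsPrime] (e : ℕ), ringKrullDim (R ⧸ p) = e → c + e = d →
      ModT p.primeCompl (LinearMap.ker β) ∧
      ModT p.primeCompl (((M →ₗ[R] R) →ₗ[R] R) ⧸ LinearMap.range β) ∧
      ∀ i, 1 ≤ i → TE p.primeCompl (M →ₗ[R] R) R i := by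
  induction c using Nat.strong_induction_on with
  | _ c ih =>
  intro p hp e he hce
  have ih' : ∀ (q : Ideal R) [q.IsPrime], q < p →
      ModT q.primeCompl (LinearMap.ker β) ∧
      ModT q.primeCompl (((M →ₗ[R] R) →ₗ[R] R) ⧸ LinearMap.range β) ∧
      ∀ i, 1 ≤ i → TE q.primeCompl (M →ₗ[R] R) R i := by
    intro q _ hqp
    obtain ⟨c', e', he', hce'⟩ := exists_dim hdim q
    obtain ⟨e'', h1, h2⟩ := dim_lt hqp he'.le
    rw [he] at h2
    have : e ≤ e'' := by exact_mod_cast h2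
    exact ih c' (by omega) q e' he' hce'
  have hRp : ∀ i < c, TE p.primeCompl (R ⧸ p) R i := fun i hi =>
    (alpha R hR e p he.le i (by omega)).mono_bot
  have hMp : ∀ i < c, TE p.primeCompl (R ⧸ p) M i := fun i hi =>
    (alpha M hM e p he.le i (by omega)).mono_bot
  have hKsm : Small p (LinearMap.ker β) := fun q _ hq => (ih' q hq).1
  have hHsm : Small p (((M →ₗ[R] R) →ₗ[R] R) ⧸ LinearMap.range β) := fun q _ hq => (ih' q hq).2.1
  have hKi := Submodule.subtype_injective (LinearMap.ker β)
  have hKe := exact_rangeRestrict (exact_ker β)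
  have hKs := LinearMap.surjective_rangeRestrict β
  have hK : 1 ≤ c → ModT p.primeCompl (LinearMap.ker β) := fun hc =>
    gamma _ hKsm (TE.cov_left0 _ hKi (hMp 0 (by omega)))
  have hBp : ∀ i < c, TE p.primeCompl (R ⧸ p) (LinearMap.range β) i := fun i hi =>
    TE.cov_right _ _ hKi hKe hKs (hMp i hi) (hK (by omega)).TE_right
  obtain ⟨l1, l2⟩ := lower hRp c (M →ₗ[R] R) (LinearMap.range β) le_rfl hBp hHsm
    (fun q _ hq => (ih' q hq).2.2)
  obtain ⟨u1, u2, u3⟩ := upper hR hdim p he hce n (M →ₗ[R] R) M β 0 hG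
    (fun f hf => LinearMap.ext fun m => by rw [← hβ, hf]; rfl)
    (fun f _ => ⟨f, fun m => (hβ m f).symm⟩) hHsm
    (fun q _ hq => (ih' q hq).2.2) (by omega) (fun h => l1 (by omega))
    (fun i hi h => l2 i hi (by omega))
  refine ⟨?_, u1, u2⟩
  rcases Nat.eq_zero_or_pos c with hc | hc
  · refine beta2 hR hdim p he hce _ hKsm ?_
    rw [hc, TE_zero_iff]
    intro f
    have hT : TE p.primeCompl (LinearMap.range β) R 1 :=
      TE.contra_left _ _ (Submodule.subtype_injective _) (exact_sub_mkQ _)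
        (Submodule.mkQ_surjective _) (u3 1 le_rfl) u1.TE_left
    obtain ⟨s, hs, ψ, hψ⟩ := extend_of_TE _ _ hKi hKe hKs hT f
    refine ⟨s, hs, ?_⟩
    rw [← hψ]
    ext k
    have hk : β k.1 = 0 := k.2
    change ψ k.1 = 0
    rw [← hβ, hk]
    rfl
  · exact hK hc

lemma ModT_max {A : Type u} [AddCommGroup A] [Module R A]
    (h : ModT (maximalIdeal R).primeCompl A) (a : A) : a = 0 := by
  obtain ⟨s, hs, hh⟩ := h a
  have hu : IsUnit s := by
    by_contra hc
    exact hs ((mem_maximalIdeal s).2 hc)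
  exact (hu.smul_eq_zero).1 hh

lemma main {d : ℕ} (hR : ∀ i < d, TE (⊥ : Submonoid R) (ResidueField R) R i)
    (hd : Nontrivial (E R (ResidueField R) R d))
    (hdim : ringKrullDim R = d) (M : Type u) [AddCommGroup M] [Module R M] [Module.Finite R M]
    (hG : FiniteGdim R (M →ₗ[R] R))
    (hfree : Module.Free R (M →ₗ[R] M))
    (h : ∀ j, 1 ≤ j → j ≤ d → TE (⊥ : Submonoid R) M M j) : Module.Free R M := by
  have hM := step1 hR M hfree h
  obtain ⟨n, hG⟩ := hG
  have he : ringKrullDim (R ⧸ maximalIdeal R) = (0 : ℕ) := by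
    rw [ringKrullDim_eq_zero_of_isField ((Ideal.Quotient.maximal_ideal_iff_isField_quotient _).1
      inferInstance)]
    rfl
  obtain ⟨h1, h2, h3⟩ := step2 hR hdim M hM hG (Module.Dual.eval R M) (fun _ _ => rfl) d
    (maximalIdeal R) 0 he (by omega)
  refine step3 hR hd M hfree h ⟨?_, ?_⟩ ?_
  · rw [← LinearMap.ker_eq_bot, LinearMap.ker_eq_bot']
    intro m hm
    exact congrArg Subtype.val (ModT_max h1 ⟨m, hm⟩)
  · intro f
    have := ModT_max h2 (Submodule.mkQ _ f)
    rwa [Submodule.mkQ_apply, Submodule.Quotient.mk_eq_zero] at this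
  · intro j hj
    have h4 : ModT (maximalIdeal R).primeCompl (E R (M →ₗ[R] R) R j) := h3 j hj
    intro ε
    refine ⟨1, one_mem _, ?_⟩
    have : ε = 0 := by
      obtain ⟨s, hs, hh⟩ := h3 j hj ε
      have hu : IsUnit s := by
        by_contra hc
        exact hs ((mem_maximalIdeal s).2 hc)
      exact (hu.smul_eq_zero).1 hh
    rw [this, smul_zero]

end step2

end Aux

end
theorem stmt4 (R : Type u) [CommRing R] [IsLocalRing R] [IsNoetherianRing R] (d : ℕ)
    (hCM : IsCMLocalOfDim R d)
    (M : Type u) [AddCommGroup M] [Module R M] [Module.Finite R M]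
    (hG : FiniteGdim R (M →ₗ[R] R))
    (hfree : Module.Free R (M →ₗ[R] M))
    (h : ∀ j : ℕ, 1 ≤ j → j ≤ d →
      Subsingleton (ExtMod R (ModuleCat.of R M) (ModuleCat.of R M) j)) :
    Module.Free R M := by
  refine Aux.main (d := d) ?_ ?_ hCM.1 M hG hfree ?_
  · intro i hi
    exact Aux.TE_of_subsingleton (Aux.depth_lt hCM.2 i hi)
  · exact Aux.depth_eq hCM.2
  · intro j h1 h2
    exact Aux.TE_of_subsingleton ((Aux.bridge _ _ _).1 (h j h1 h2))
end

section
/- Let R be a Cohen-Macaulay local ring of dimension d and let M be a finitely generated R-module such that Hom_R(M,R) has finite Gorenstein dimension. If Hom_R(M,M) has finite projective dimension and Ext^i_R(M,R) = 0 = Ext^j_R(M,M) for all 1 ≤ i ≤ d and 1 ≤ j ≤ d, then M is free. -/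
open CategoryTheory Opposite

universe u

namespace S5

open Abelian

variable {R : Type u} [CommRing R]

theorem exists_desc {M N : ModuleCat.{u} R} (P : ProjectiveResolution M)
    (f : P.complex.X 0 ⟶ N) (hf : P.complex.d 1 0 ≫ f = 0) :
    ∃ g : M ⟶ N, P.π.f 0 ≫ g = f := by
  obtain ⟨g, hg⟩ := P.exact₀.desc' f hf
  exact ⟨g, hg⟩

theorem sub_iff_complex (M N : ModuleCat.{u} R) (P : ProjectiveResolution M) (i : ℕ) :
    Subsingleton (ExtMod R M N i) ↔ ((P.complex.linearYonedaObj R N).ExactAt i) := by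
  rw [HomologicalComplex.exactAt_iff_isZero_homology, ModuleCat.isZero_iff_subsingleton]
  exact (P.isoExt (R := R) i N).toLinearEquiv.toEquiv.subsingleton_congr

theorem ext_iff (M N : ModuleCat.{u} R) (i : ℕ) :
    Subsingleton (ExtMod R M N i) ↔ Subsingleton (Abelian.Ext M N i) := by
  let P := ProjectiveResolution.of M
  rw [sub_iff_complex M N P]
  cases i with
  | zero =>
    rw [Abelian.Ext.homEquiv₀.subsingleton_congr, 
      HomologicalComplex.exactAt_iff' _ 0 0 1 (by simp) (by simp), ShortComplex.moduleCat_exact_iff]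
    constructor
    · intro h
      refine ⟨fun a b => ?_⟩
      rw [← sub_eq_zero]
      obtain ⟨x, hx⟩ := h (P.π.f 0 ≫ (a - b)) (by
        change P.complex.d 1 0 ≫ P.π.f 0 ≫ (a - b) = 0
        exact (Category.assoc _ _ _).symm.trans
          ((congrArg (fun t => t ≫ (a - b)) P.complex_d_comp_π_f_zero).trans Limits.zero_comp))
      have h0 : P.π.f 0 ≫ (a - b) = 0 := by
        rw [← hx]
        simp
        rfl
      exact (cancel_epi (P.π.f 0)).1 (h0.trans Limits.comp_zero.symm)
    · intro h x hx
      obtain ⟨g, hg⟩ := exists_desc P x hx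
      refine ⟨0, ?_⟩
      rw [← hg, Subsingleton.elim g 0]
      simp; rfl
  | succ i =>
    rw [HomologicalComplex.exactAt_iff' _ i (i+1) (i+2) (by simp) (by simp), ShortComplex.moduleCat_exact_iff]
    constructor
    · intro h
      refine subsingleton_of_forall_eq 0 fun a => ?_
      obtain ⟨f, hf, rfl⟩ := P.extMk_surjective a (i+2) rfl
      rw [P.extMk_eq_zero_iff f _ _ _ i rfl]
      exact h f hf
    · intro h x hx
      have := Subsingleton.elim (P.extMk x (i+2) rfl hx) 0
      exact (P.extMk_eq_zero_iff x _ _ _ i rfl).1 this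


/-- Ext groups of unbundled modules. -/
abbrev EX (R : Type u) [CommRing R] (X Y : Type u) [AddCommGroup X] [Module R X]
    [AddCommGroup Y] [Module R Y] (n : ℕ) : Type u :=
  Abelian.Ext (ModuleCat.of R X) (ModuleCat.of R Y) n

/-- Vanishing of Ext. -/
def EZ (R : Type u) [CommRing R] (X Y : Type u) [AddCommGroup X] [Module R X]
    [AddCommGroup Y] [Module R Y] (n : ℕ) : Prop :=
  ∀ x : EX R X Y n, x = 0

section wrappers

variable {X Y Z A B C : Type u} [AddCommGroup X] [Module R X] [AddCommGroup Y] [Module R Y]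
  [AddCommGroup Z] [Module R Z] [AddCommGroup A] [Module R A] [AddCommGroup B] [Module R B]
  [AddCommGroup C] [Module R C] {n : ℕ}

theorem EZ_iff : EZ R X Y n ↔
    Subsingleton (ExtMod R (ModuleCat.of R X) (ModuleCat.of R Y) n) := by
  rw [ext_iff]
  exact ⟨fun h => subsingleton_of_forall_eq 0 h, fun h x => Subsingleton.elim _ _⟩

/-- Functoriality of Ext in the second variable. -/
noncomputable def push (f : Y →ₗ[R] Z) : EX R X Y n →ₗ[R] EX R X Z n where
  toFun x := x.comp (Ext.mk₀ (ModuleCat.ofHom f)) (add_zero n)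
  map_add' x y := by simp
  map_smul' r x := by simp

theorem push_def (f : Y →ₗ[R] Z) (x : EX R X Y n) :
    push f x = x.comp (Ext.mk₀ (ModuleCat.ofHom f)) (add_zero n) := rfl

theorem push_id (x : EX R X Y n) : push (LinearMap.id : Y →ₗ[R] Y) x = x := by
  simp [push_def]

theorem push_push (f : Y →ₗ[R] Z) (g : Z →ₗ[R] A) (x : EX R X Y n) :
    push g (push f x) = push (g ∘ₗ f) x := by
  simp only [push_def]
  rw [Ext.comp_assoc_of_third_deg_zero, Ext.mk₀_comp_mk₀]
  rfl

theorem push_add (f g : Y →ₗ[R] Z) (x : EX R X Y n) : push (f + g) x = push f x + push g x := by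
  simp only [push_def]
  rw [ModuleCat.ofHom_add, Ext.mk₀_add, Ext.comp_add]

theorem push_zero (x : EX R X Y n) : push (0 : Y →ₗ[R] Z) x = 0 := by
  simp only [push_def]
  rw [ModuleCat.ofHom_zero, Ext.mk₀_zero, Ext.comp_zero]

theorem push_smul (r : R) (f : Y →ₗ[R] Z) (x : EX R X Y n) : push (r • f) x = r • push f x := by
  simp only [push_def]
  have : ModuleCat.ofHom (r • f) = r • ModuleCat.ofHom f := rfl
  rw [this, Ext.mk₀_smul, Ext.comp_smul]

/-- `push` as an additive map in the linear map. -/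
noncomputable def pushHom (x : EX R X Y n) : (Y →ₗ[R] Z) →+ EX R X Z n where
  toFun f := push f x
  map_zero' := push_zero x
  map_add' f g := push_add f g x

theorem push_sum {ι : Type*} (s : Finset ι) (f : ι → (Y →ₗ[R] Z)) (x : EX R X Y n) :
    push (∑ i ∈ s, f i) x = ∑ i ∈ s, push (f i) x :=
  map_sum (pushHom (Z := Z) x) f s

theorem push_inj_of_retract (f : Y →ₗ[R] Z) (g : Z →ₗ[R] Y) (h : g ∘ₗ f = LinearMap.id) :
    Function.Injective (push f : EX R X Y n →ₗ[R] EX R X Z n) := by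
  intro a b hab
  have := congrArg (push g) hab
  rwa [push_push, push_push, h, push_id, push_id] at this

theorem push_inj_of_bijective (f : Y →ₗ[R] Z) (h : Function.Bijective f) :
    Function.Injective (push f : EX R X Y n →ₗ[R] EX R X Z n) :=
  push_inj_of_retract f (LinearEquiv.ofBijective f h).symm.toLinearMap (by
    ext x; exact (LinearEquiv.ofBijective f h).symm_apply_apply x)

theorem EZ_congr_right (e : Y ≃ₗ[R] Z) (h : EZ R X Z n) : EZ R X Y n := by
  intro x
  apply push_inj_of_bijective e.toLinearMap e.bijective
  rw [h (push _ x), map_zero]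

theorem EZ_congr_left (e : Y ≃ₗ[R] Z) (h : EZ R Z X n) : EZ R Y X n := by
  intro x
  have h1 : (Ext.mk₀ (ModuleCat.ofHom e.toLinearMap)).comp
      ((Ext.mk₀ (ModuleCat.ofHom e.symm.toLinearMap)).comp x (zero_add n)) (zero_add n) = x := by
    rw [Ext.mk₀_comp_mk₀_assoc, ← ModuleCat.ofHom_comp]
    simp
  rw [← h1, h ((Ext.mk₀ (ModuleCat.ofHom e.symm.toLinearMap)).comp x (zero_add n)), Ext.comp_zero]

theorem EZ_proj [Module.Projective R X] : EZ R X Y (n + 1) := by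
  intro x
  have : Projective (ModuleCat.of R X) := (IsProjective.iff_projective X).1 ‹_›
  exact Ext.eq_zero_of_projective x

/-- A short exact sequence. -/
theorem ses (f : A →ₗ[R] B) (g : B →ₗ[R] C) (hf : Function.Injective f)
    (hg : Function.Surjective g) (hfg : Function.Exact f g) :
    (ShortComplex.mk (ModuleCat.ofHom f) (ModuleCat.ofHom g) (by
      rw [← ModuleCat.ofHom_comp, hfg.linearMap_comp_eq_zero]; rfl)).ShortExact := by
  refine @ShortComplex.ShortExact.mk _ _ _ _ ?_ ?_ ?_
  · rw [ShortComplex.moduleCat_exact_iff]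
    intro x hx
    exact (hfg x).1 hx
  · exact (ModuleCat.mono_iff_injective _).2 hf
  · exact (ModuleCat.epi_iff_surjective _).2 hg

theorem cov_inj0 (f : A →ₗ[R] B) (hf : Function.Injective f) :
    Function.Injective (push f : EX R X A 0 →ₗ[R] EX R X B 0) := by
  have : Mono (ModuleCat.ofHom f) := (ModuleCat.mono_iff_injective _).2 hf
  exact Ext.postcomp_mk₀_injective_of_mono (ModuleCat.of R X) (ModuleCat.ofHom f)

section
variable (f : A →ₗ[R] B) (g : B →ₗ[R] C) (hf : Function.Injective f)
    (hg : Function.Surjective g) (hfg : Function.Exact f g)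
include hf hg hfg

theorem cov_inj (h : EZ R X C n) :
    Function.Injective (push f : EX R X A (n+1) →ₗ[R] EX R X B (n+1)) := by
  rw [injective_iff_map_eq_zero]
  intro x hx
  obtain ⟨y, hy⟩ := Ext.covariant_sequence_exact₁ _ (ses f g hf hg hfg) x hx rfl
  rw [← hy, h y, Ext.zero_comp]

theorem cov_exact (x : EX R X B n) (hx : push g x = 0) : ∃ y : EX R X A n, push f y = x :=
  Ext.covariant_sequence_exact₂ _ (ses f g hf hg hfg) x hx

theorem con_left (hB : EZ R B Y n) (hC : EZ R C Y (n+1)) : EZ R A Y n := by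
  intro x
  obtain ⟨y, hy⟩ := Ext.contravariant_sequence_exact₁ (ses f g hf hg hfg) _ x (add_comm 1 n) (hC _)
  rw [← hy, hB y, Ext.comp_zero]

theorem con_right (hA : EZ R A Y n) (hB : EZ R B Y (n+1)) : EZ R C Y (n+1) := by
  intro x
  obtain ⟨y, hy⟩ := Ext.contravariant_sequence_exact₃ (ses f g hf hg hfg) _ x (hB _) (add_comm 1 n)
  rw [← hy, hA y, Ext.comp_zero]

theorem con_extend (hC : EZ R C Y 1) (u : A →ₗ[R] Y) : ∃ v : B →ₗ[R] Y, v ∘ₗ f = u := by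
  obtain ⟨y, hy⟩ := Ext.contravariant_sequence_exact₁ (ses f g hf hg hfg) _
    (Ext.mk₀ (ModuleCat.ofHom u)) (add_zero 1) (hC _)
  obtain ⟨w, rfl⟩ := (Ext.mk₀_bijective _ _).2 y
  rw [Ext.mk₀_comp_mk₀] at hy
  have := (Ext.mk₀_bijective _ _).1 hy
  exact ⟨w.hom, congrArg ModuleCat.Hom.hom this⟩

theorem con_right_one (hA : ∀ u : A →ₗ[R] Y, ∃ v : B →ₗ[R] Y, v ∘ₗ f = u) (hB : EZ R B Y 1) :
    EZ R C Y 1 := by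
  intro x
  obtain ⟨y, hy⟩ := Ext.contravariant_sequence_exact₃ (ses f g hf hg hfg) _ x (hB _) (add_zero 1)
  obtain ⟨w, rfl⟩ := (Ext.mk₀_bijective _ _).2 y
  obtain ⟨v, hv⟩ := hA w.hom
  have hw : w = ModuleCat.ofHom f ≫ ModuleCat.ofHom v := by
    apply ModuleCat.hom_ext
    exact hv.symm
  rw [← hy, hw, ← Ext.mk₀_comp_mk₀]
  exact (ses f g hf hg hfg).extClass_comp_assoc (Ext.mk₀ (ModuleCat.ofHom v))

end

theorem EZ_cov_left (f : A →ₗ[R] B) (g : B →ₗ[R] C) (hf : Function.Injective f)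
    (hg : Function.Surjective g) (hfg : Function.Exact f g) 
    (hC : EZ R X C n) (hB : EZ R X B (n+1)) : EZ R X A (n+1) := by
  intro x
  apply cov_inj f g hf hg hfg hC
  rw [hB (push f x), map_zero]

end wrappers

section homlemmas

variable {X L : Type u} [AddCommGroup X] [Module R X] [AddCommGroup L] [Module R L]

/-- Evaluation at an element. -/
def ev {N : Type u} [AddCommGroup N] [Module R N] (L : Type u) [AddCommGroup L] [Module R L]
    (x : N) : (N →ₗ[R] L) →ₗ[R] L :=
  LinearMap.applyₗ x

@[simp] theorem ev_apply {N : Type u} [AddCommGroup N] [Module R N] (x : N) (f : N →ₗ[R] L) :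
    ev L x f = f x := rfl

/-- Precomposition. -/
def pre {N N' : Type u} [AddCommGroup N] [Module R N] [AddCommGroup N'] [Module R N']
    (L : Type u) [AddCommGroup L] [Module R L] (p : N' →ₗ[R] N) :
    (N →ₗ[R] L) →ₗ[R] (N' →ₗ[R] L) :=
  LinearMap.lcomp R L p

@[simp] theorem pre_apply {N N' : Type u} [AddCommGroup N] [Module R N] [AddCommGroup N']
    [Module R N'] (p : N' →ₗ[R] N) (f : N →ₗ[R] L) (x : N') :
    pre L p f x = f (p x) := rfl

section free
variable {F : Type u} [AddCommGroup F] [Module R F] [Module.Free R F] [Module.Finite R F] {n : ℕ}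

/-- The map `L → Hom(F,L)` attached to a basis element. -/
noncomputable def inc (i : Module.Free.ChooseBasisIndex R F) : L →ₗ[R] (F →ₗ[R] L) :=
  LinearMap.smulRightₗ ((Module.Free.chooseBasis R F).coord i)

@[simp] theorem inc_apply (i : Module.Free.ChooseBasisIndex R F) (l : L) (x : F) :
    inc i l x = (Module.Free.chooseBasis R F).coord i x • l := rfl

theorem sum_inc : (∑ i, (inc i : L →ₗ[R] (F →ₗ[R] L)) ∘ₗ ev L (Module.Free.chooseBasis R F i)) =
    LinearMap.id := by
  ext f x
  simp only [LinearMap.sum_apply, LinearMap.comp_apply, inc_apply, ev_apply, LinearMap.id_apply]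
  conv_rhs => rw [← (Module.Free.chooseBasis R F).sum_repr x, map_sum]
  refine Finset.sum_congr rfl fun i _ => ?_
  rw [map_smul]
  rfl

theorem free_inj (ξ : EX R X (F →ₗ[R] L) n) (h : ∀ x : F, push (ev L x) ξ = 0) : ξ = 0 := by
  rw [← push_id ξ, ← sum_inc, push_sum]
  refine Finset.sum_eq_zero fun i _ => ?_
  rw [← push_push, h, map_zero]

theorem free_surj (g : F →ₗ[R] EX R X L n) :
    ∃ ξ : EX R X (F →ₗ[R] L) n, ∀ x, push (ev L x) ξ = g x := by
  refine ⟨∑ i, push (inc i) (g (Module.Free.chooseBasis R F i)), fun x => ?_⟩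
  rw [map_sum]
  conv_rhs => rw [← (Module.Free.chooseBasis R F).sum_repr x]
  rw [map_sum]
  refine Finset.sum_congr rfl fun i _ => ?_
  rw [push_push, map_smul]
  have : ev L x ∘ₗ inc i = ((Module.Free.chooseBasis R F).repr x i) • LinearMap.id := by
    ext l; simp
  rw [this, push_smul, push_id]

theorem free_zero (h : EZ R X L n) : EZ R X (F →ₗ[R] L) n :=
  fun ξ => free_inj ξ fun _ => h _

end free

section pres

variable {N F : Type u} [AddCommGroup N] [Module R N] [AddCommGroup F] [Module R F]
  (p : F →ₗ[R] N)

/-- Restriction to the kernel. -/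
abbrev resK (L : Type u) [AddCommGroup L] [Module R L] :
    (F →ₗ[R] L) →ₗ[R] (LinearMap.ker p →ₗ[R] L) :=
  pre L (LinearMap.ker p).subtype

/-- The image of the restriction map. -/
abbrev QQ (L : Type u) [AddCommGroup L] [Module R L] : Submodule R (LinearMap.ker p →ₗ[R] L) :=
  LinearMap.range (resK p L)

variable (hp : Function.Surjective p)
include hp

theorem pre_inj : Function.Injective (pre L p) := by
  intro f g h
  ext x
  obtain ⟨y, rfl⟩ := hp x
  exact LinearMap.congr_fun h y

theorem pre_exact : Function.Exact (pre L p) (resK p L).rangeRestrict := by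
  intro f
  constructor
  · intro h
    have h' : ∀ y ∈ LinearMap.ker p, f y = 0 := fun y hy =>
      LinearMap.congr_fun (congrArg Subtype.val h) ⟨y, hy⟩
    have hs : ∀ y, p (Function.surjInv hp (p y)) = p y := fun y => Function.surjInv_eq hp _
    have key : ∀ a b, p a = p b → f a = f b := by
      intro a b hab
      rw [← sub_eq_zero, ← map_sub]
      exact h' _ (by simp [hab])
    refine ⟨⟨⟨fun x => f (Function.surjInv hp x), fun x y => ?_⟩, fun r x => ?_⟩, ?_⟩
    · rw [← map_add]
      exact key _ _ (by simp [Function.surjInv_eq hp])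
    · simp only [RingHom.id_apply]
      rw [← map_smul]
      exact key _ _ (by simp [Function.surjInv_eq hp])
    · ext y
      exact key _ _ (hs y)
  · rintro ⟨g, rfl⟩
    ext y
    have : p y.1 = 0 := y.2
    simp [this]

theorem ker_exact : Function.Exact (LinearMap.ker p).subtype p := by
  intro x
  simp

theorem QQ_top (h : EZ R N L 1) : QQ p L = ⊤ := by
  rw [LinearMap.range_eq_top]
  intro u
  obtain ⟨v, hv⟩ := con_extend (LinearMap.ker p).subtype p (Submodule.subtype_injective _) hp
    (ker_exact p hp) h u
  exact ⟨v, hv⟩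

theorem QQ_inj {t : ℕ} (h : t = 0 ∨ EZ R N L 1) :
    Function.Injective (push (QQ p L).subtype : EX R X (QQ p L) t →ₗ[R] _) := by
  rcases h with rfl | h
  · exact cov_inj0 _ (Submodule.subtype_injective _)
  · apply push_inj_of_bijective
    refine ⟨Submodule.subtype_injective _, fun x => ⟨⟨x, ?_⟩, rfl⟩⟩
    rw [QQ_top p hp h]; trivial

theorem ker_EZ [Module.Projective R F] {j : ℕ} (h : EZ R N L (j + 2)) :
    EZ R (LinearMap.ker p) L (j + 1) :=
  con_left (LinearMap.ker p).subtype p (Submodule.subtype_injective _) hp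
    (ker_exact p hp) EZ_proj h

end pres

theorem hom_zero_aux [IsNoetherianRing R] (i : ℕ) (hL : ∀ l ≤ i, EZ R X L l) :
    (∀ (N : Type u) [AddCommGroup N] [Module R N] [Module.Finite R N],
      (∀ j, 1 ≤ j → j + 1 ≤ i → EZ R N L j) → EZ R X (N →ₗ[R] L) i) ∧
    (∀ (N F : Type u) [AddCommGroup N] [Module R N] [Module.Finite R N] [AddCommGroup F]
      [Module R F] [Module.Finite R F] [Module.Free R F] (p : F →ₗ[R] N), Function.Surjective p →
      (∀ j, 1 ≤ j → j ≤ i → EZ R N L j) → EZ R X (QQ p L) i) := by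
  induction i with
  | zero =>
    have h0 : ∀ (N : Type u) [AddCommGroup N] [Module R N] [Module.Finite R N],
        EZ R X (N →ₗ[R] L) 0 := by
      intro N _ _ _ ξ
      obtain ⟨n, p, hp⟩ := Module.Finite.exists_fin' R N
      apply cov_inj0 (pre L p) (pre_inj p hp)
      rw [free_zero (hL 0 le_rfl) (push _ ξ), map_zero]
    refine ⟨fun N _ _ _ _ => h0 N, ?_⟩
    intro N F _ _ _ _ _ _ _ p hp _ ξ
    apply QQ_inj p hp (Or.inl rfl)
    rw [h0 (LinearMap.ker p) (push _ ξ), map_zero]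
  | succ i ih =>
    obtain ⟨ih1, ih2⟩ := ih fun l hl => hL l (by lia)
    have h1 : (∀ (N : Type u) [AddCommGroup N] [Module R N] [Module.Finite R N],
      (∀ j, 1 ≤ j → j + 1 ≤ i + 1 → EZ R N L j) → EZ R X (N →ₗ[R] L) (i + 1)) := by
      intro N _ _ _ hN
      obtain ⟨n, p, hp⟩ := Module.Finite.exists_fin' R N
      exact EZ_cov_left (pre L p) _ (pre_inj p hp) (LinearMap.surjective_rangeRestrict _)
        (pre_exact p hp) (ih2 N _ p hp fun j h1 h2 => hN j h1 (by lia))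
        (free_zero (hL (i+1) le_rfl))
    refine ⟨h1, ?_⟩
    intro N F _ _ _ _ _ _ _ p hp hN ξ
    apply QQ_inj p hp (Or.inr (hN 1 le_rfl (by lia)))
    rw [h1 (LinearMap.ker p) (fun j hj1 hj2 => ?_) (push _ ξ), map_zero]
    obtain ⟨j, rfl⟩ : ∃ j', j = j' + 1 := ⟨j - 1, by lia⟩
    exact ker_EZ p hp (hN _ (by lia) (by lia))

theorem hom_zero [IsNoetherianRing R] {i : ℕ} (hL : ∀ l ≤ i, EZ R X L l)
    (N : Type u) [AddCommGroup N] [Module R N] [Module.Finite R N]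
    (hN : ∀ j, 1 ≤ j → j + 1 ≤ i → EZ R N L j) : EZ R X (N →ₗ[R] L) i :=
  (hom_zero_aux i hL).1 N hN

theorem QQ_zero [IsNoetherianRing R] {i : ℕ} (hL : ∀ l ≤ i, EZ R X L l)
    {N F : Type u} [AddCommGroup N] [Module R N] [Module.Finite R N] [AddCommGroup F]
    [Module R F] [Module.Finite R F] [Module.Free R F] (p : F →ₗ[R] N)
    (hp : Function.Surjective p)
    (hN : ∀ j, 1 ≤ j → j ≤ i → EZ R N L j) : EZ R X (QQ p L) i :=
  (hom_zero_aux i hL).2 N F p hp hN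

theorem push_pre_inj [IsNoetherianRing R] {t : ℕ} (hL : ∀ l < t, EZ R X L l)
    {N F : Type u} [AddCommGroup N] [Module R N] [Module.Finite R N] [AddCommGroup F]
    [Module R F] [Module.Finite R F] [Module.Free R F] (p : F →ₗ[R] N)
    (hp : Function.Surjective p)
    (hN : ∀ j, 1 ≤ j → j + 1 ≤ t → EZ R N L j) :
    Function.Injective (push (pre L p) : EX R X (N →ₗ[R] L) t →ₗ[R] _) := by
  cases t with
  | zero => exact cov_inj0 _ (pre_inj p hp)
  | succ t =>
    exact cov_inj (pre L p) _ (pre_inj p hp) (LinearMap.surjective_rangeRestrict _)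
        (pre_exact p hp) (QQ_zero (fun l hl => hL l (by lia)) p hp
          fun j h1 h2 => hN j h1 (by lia))

theorem hom_inj [IsNoetherianRing R] {t : ℕ} (hL : ∀ l < t, EZ R X L l)
    {N : Type u} [AddCommGroup N] [Module R N] [Module.Finite R N]
    (hN : ∀ j, 1 ≤ j → j + 1 ≤ t → EZ R N L j)
    (ξ : EX R X (N →ₗ[R] L) t) (h : ∀ x : N, push (ev L x) ξ = 0) : ξ = 0 := by
  obtain ⟨n, p, hp⟩ := Module.Finite.exists_fin' R N
  apply push_pre_inj hL p hp hN
  rw [map_zero]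
  refine free_inj _ fun y => ?_
  rw [push_push]
  exact h (p y)

theorem hom_surj [IsNoetherianRing R] {t : ℕ} (hL : ∀ l < t, EZ R X L l)
    {N : Type u} [AddCommGroup N] [Module R N] [Module.Finite R N]
    (hN : ∀ j, 1 ≤ j → j ≤ t → EZ R N L j)
    (g : N →ₗ[R] EX R X L t) : ∃ ξ : EX R X (N →ₗ[R] L) t, ∀ x : N, push (ev L x) ξ = g x := by
  obtain ⟨n, p, hp⟩ := Module.Finite.exists_fin' R N
  obtain ⟨η, hη⟩ := free_surj (g ∘ₗ p)
  have h0 : push (resK p L).rangeRestrict η = 0 := by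
    apply QQ_inj p hp (t := t) (by
      rcases Nat.eq_zero_or_pos t with h | h
      · exact Or.inl h
      · exact Or.inr (hN 1 le_rfl h))
    rw [map_zero]
    apply hom_inj hL
    · intro j h1 h2
      obtain ⟨j, rfl⟩ : ∃ j', j = j' + 1 := ⟨j - 1, by lia⟩
      exact ker_EZ p hp (hN _ (by lia) (by lia))
    · intro y
      rw [push_push, push_push]
      refine (hη y.1).trans ?_
      have : p y.1 = 0 := y.2
      simp [this]
  obtain ⟨ξ, hξ⟩ := cov_exact (pre L p) _ (pre_inj p hp) (LinearMap.surjective_rangeRestrict _)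
        (pre_exact p hp) η h0
  refine ⟨ξ, fun x => ?_⟩
  obtain ⟨y, rfl⟩ := hp x
  have := hη y
  rw [← hξ, push_push] at this
  exact this

end homlemmas

section localring

variable [IsLocalRing R] [IsNoetherianRing R] {d : ℕ}

/-- residue field -/
local notation "κ" => IsLocalRing.ResidueField R

theorem max_smul {Y : Type u} [AddCommGroup Y] [Module R Y] {n : ℕ} (r : R)
    (hr : r ∈ IsLocalRing.maximalIdeal R) (v : EX R (IsLocalRing.ResidueField R) Y n) :
    r • v = 0 := by
  have h0 : r • (𝟙 (ModuleCat.of R (IsLocalRing.ResidueField R))) = 0 := by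
    apply ModuleCat.hom_ext
    ext x
    change r • (show IsLocalRing.ResidueField R from x) = 0
    rw [Algebra.smul_def]
    have : algebraMap R (IsLocalRing.ResidueField R) r = 0 :=
      (IsLocalRing.residue_eq_zero_iff r).2 hr
    rw [this, zero_mul]
  have : r • v = (Ext.mk₀ (r • (𝟙 (ModuleCat.of R (IsLocalRing.ResidueField R))))).comp v
      (zero_add n) := by
    rw [Ext.mk₀_smul, Ext.smul_comp, Ext.mk₀_id_comp]
  rw [this, h0, Ext.mk₀_zero, Ext.zero_comp]

/-- Setup for a ring of depth `d`. -/
structure Dep (R : Type u) [CommRing R] [IsLocalRing R] (d : ℕ) : Prop where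
  z : ∀ i < d, EZ R (IsLocalRing.ResidueField R) R i
  nz : ∃ v : EX R (IsLocalRing.ResidueField R) R d, v ≠ 0

theorem exists_to_V {N Y : Type u} [AddCommGroup N] [Module R N] [Module.Finite R N]
    [AddCommGroup Y] [Module R Y] {n : ℕ} (v : EX R (IsLocalRing.ResidueField R) Y n)
    (hv : v ≠ 0) (S : Submodule R N) (hS : S ≠ ⊤) :
    ∃ g : N →ₗ[R] EX R (IsLocalRing.ResidueField R) Y n, g ≠ 0 ∧ ∀ x ∈ S, g x = 0 := by
  obtain ⟨C, hC, hSC⟩ := (eq_top_or_exists_le_coatom S).resolve_left hS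
  have : IsSimpleModule R (N ⧸ C) := isSimpleModule_iff_isCoatom.2 hC
  obtain ⟨I, hI, ⟨e⟩⟩ := isSimpleModule_iff_quot_maximal.1 this
  have hI' := IsLocalRing.eq_maximalIdeal hI
  let q : (R ⧸ I) →ₗ[R] EX R (IsLocalRing.ResidueField R) Y n :=
    Submodule.liftQ I (LinearMap.toSpanSingleton R _ v) (by
      intro r hr
      rw [hI'] at hr
      exact max_smul r hr v)
  refine ⟨q ∘ₗ e.toLinearMap ∘ₗ C.mkQ, ?_, ?_⟩
  · intro h
    obtain ⟨x, hx⟩ := C.mkQ_surjective (e.symm (Submodule.Quotient.mk 1))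
    have := LinearMap.congr_fun h x
    simp only [LinearMap.comp_apply, hx, LinearEquiv.coe_coe, LinearEquiv.apply_symm_apply,
      LinearMap.zero_apply] at this
    apply hv
    rw [← this]
    change v = LinearMap.toSpanSingleton R _ v 1
    simp
  · intro x hx
    have : C.mkQ x = 0 := (Submodule.Quotient.mk_eq_zero _).2 (hSC hx)
    simp only [LinearMap.comp_apply, this, map_zero]

theorem surj_crit (hD : Dep R d) {N N2 : Type u} [AddCommGroup N] [Module R N] [Module.Finite R N]
    [AddCommGroup N2] [Module R N2] [Module.Finite R N2]
    (hN : ∀ j, 1 ≤ j → j ≤ d → EZ R N R j) (hN2 : ∀ j, 1 ≤ j → j + 1 ≤ d → EZ R N2 R j)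
    (ψ : N2 →ₗ[R] N)
    (hψ : Function.Injective (push (pre R ψ) : EX R (IsLocalRing.ResidueField R) (N →ₗ[R] R) d →ₗ[R] _)) :
    Function.Surjective ψ := by
  rw [← LinearMap.range_eq_top]
  by_contra hS
  obtain ⟨v, hv⟩ := hD.nz
  obtain ⟨g, hg, hg0⟩ := exists_to_V v hv _ hS
  obtain ⟨ξ, hξ⟩ := hom_surj hD.z hN g
  have : ξ = 0 := by
    apply hψ
    rw [map_zero]
    refine hom_inj hD.z hN2 _ fun x => ?_
    rw [push_push]
    exact (hξ (ψ x)).trans (hg0 _ ⟨x, rfl⟩)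
  apply hg
  ext x
  rw [← hξ, this, map_zero]; rfl

/-- Totally reflexive, in terms of `EZ`. -/
structure TR (R : Type u) [CommRing R] (G : Type u) [AddCommGroup G] [Module R G] : Prop where
  bij : Function.Bijective (Module.Dual.eval R G)
  e : ∀ i, EZ R G R (i + 1)
  e' : ∀ i, EZ R (G →ₗ[R] R) R (i + 1)

theorem TR_of {G : Type u} [AddCommGroup G] [Module R G] (h : TotallyReflexive R G) : TR R G :=
  ⟨h.1, fun i => EZ_iff.2 (h.2 (i+1) (by lia)).1, fun i => EZ_iff.2 (h.2 (i+1) (by lia)).2⟩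

section
variable {G' G Z : Type u} [AddCommGroup G] [Module R G] [AddCommGroup G'] [Module R G']
  [AddCommGroup Z] [Module R Z] [Module.Finite R G] [Module.Finite R G']

/-- evaluation with explicit types -/
def evl (G : Type u) [AddCommGroup G] [Module R G] : G →ₗ[R] ((G →ₗ[R] R) →ₗ[R] R) :=
  Module.Dual.eval R G

theorem evl_nat (f : G' →ₗ[R] G) : pre R (pre R f) ∘ₗ evl G' = evl G ∘ₗ f := rfl

theorem TR.bij' (hG : TR R G) : Function.Bijective (evl (R := R) G) := hG.bij

theorem Sh (hD : Dep R d) (hG' : TR R G') (hG : TR R G) (f : G' →ₗ[R] G)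
    (hf : Function.Injective (push f : EX R (IsLocalRing.ResidueField R) G' d →ₗ[R] _)) :
    Function.Surjective (pre R f) := by
  apply surj_crit hD
  · intro j h1 _
    obtain ⟨j, rfl⟩ : ∃ j', j = j' + 1 := ⟨j - 1, by lia⟩
    exact hG'.e' j
  · intro j h1 _
    obtain ⟨j, rfl⟩ : ∃ j', j = j' + 1 := ⟨j - 1, by lia⟩
    exact hG.e' j
  · rw [injective_iff_map_eq_zero]
    intro ξ hξ
    let e := LinearEquiv.ofBijective (evl G') hG'.bij'
    have he : e.toLinearMap = evl G' := rfl
    have h1 : push (evl G') (push e.symm.toLinearMap ξ) = ξ := by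
      rw [push_push, ← he]
      have : e.toLinearMap ∘ₗ e.symm.toLinearMap = LinearMap.id := by
        ext1 x; exact e.apply_symm_apply x
      rw [this, push_id]
    have h2 : push e.symm.toLinearMap ξ = 0 := by
      apply hf
      apply push_inj_of_bijective (evl G) hG.bij'
      rw [push_push, map_zero, map_zero, ← evl_nat, ← push_push, h1, hξ]
    rw [← h1, h2, map_zero]

theorem depth_TR (hD : Dep R d) (hG : TR R G) {i : ℕ} (hi : i < d) :
    EZ R (IsLocalRing.ResidueField R) G i := by
  refine EZ_congr_right (LinearEquiv.ofBijective (evl G) hG.bij') ?_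
  refine hom_zero (fun l hl => hD.z l (by lia)) (G →ₗ[R] R) fun j h1 _ => ?_
  obtain ⟨j, rfl⟩ : ∃ j', j = j' + 1 := ⟨j - 1, by lia⟩
  exact hG.e' j

theorem Zquot (hD : Dep R d) (hG' : TR R G') (hG : TR R G) (f : G' →ₗ[R] G) (g : G →ₗ[R] Z)
    (hf : Function.Injective f) (hg : Function.Surjective g) (hfg : Function.Exact f g)
    (hZ : ∀ i, i + 1 = d → EZ R (IsLocalRing.ResidueField R) Z i) :
    Function.Surjective (pre R f) ∧ TR R Z := by
  have hs : Function.Surjective (pre R f) := by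
    apply Sh hD hG' hG
    cases d with
    | zero => exact cov_inj0 f hf
    | succ d => exact cov_inj f g hf hg hfg (hZ d rfl)
  have hdx : Function.Exact (pre R g) (pre R f) := by
    intro h
    constructor
    · intro h0
      refine (pre_exact g hg h).1 ?_
      apply Subtype.ext
      ext y
      obtain ⟨w, hw⟩ := (hfg y.1).1 y.2
      change h y.1 = 0
      rw [← hw]
      exact LinearMap.congr_fun h0 w
    · rintro ⟨w, rfl⟩
      ext y
      have : g (f y) = 0 := (hfg (f y)).2 ⟨y, rfl⟩
      simp [this]
  refine ⟨hs, ⟨⟨?_, ?_⟩, ?_, ?_⟩⟩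
  · rw [injective_iff_map_eq_zero]
    intro z hz
    obtain ⟨x, rfl⟩ := hg z
    -- eval x factors through G'*
    have h0 : ∀ h : G →ₗ[R] R, pre R f h = 0 → h x = 0 := by
      intro h hh
      obtain ⟨w, rfl⟩ := (hdx h).1 hh
      exact LinearMap.congr_fun hz w
    obtain ⟨θ, hθ⟩ : ∃ θ : (G' →ₗ[R] R) →ₗ[R] R, θ ∘ₗ pre R f = Module.Dual.eval R G x := by
      obtain ⟨θ, hθ⟩ := (pre_exact (L := R) (pre R f) hs (Module.Dual.eval R G x)).1 (by
        apply Subtype.ext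
        ext y
        exact h0 y.1 y.2)
      exact ⟨θ, hθ⟩
    obtain ⟨x', rfl⟩ := hG'.bij.2 θ
    refine (hfg x).2 ⟨x', ?_⟩
    apply hG.bij.1
    rw [← hθ]; rfl
  · intro Θ
    obtain ⟨Θ', hΘ⟩ := con_extend (pre R g) (pre R f) (pre_inj g hg) hs hdx (hG'.e' 0) Θ
    obtain ⟨x, rfl⟩ := hG.bij.2 Θ'
    exact ⟨g x, hΘ⟩
  · intro i
    cases i with
    | zero => exact con_right_one f g hf hg hfg hs (hG.e 0)
    | succ i => exact con_right f g hf hg hfg (hG'.e i) (hG.e _)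
  · intro i
    exact con_left (pre R g) (pre R f) (pre_inj g hg) hs hdx (hG.e' i) (hG'.e' _)

end

end localring

section localring2

variable [IsLocalRing R] [IsNoetherianRing R] {d : ℕ}

theorem depth_ker {G Z : Type u} [AddCommGroup G] [Module R G] [Module.Finite R G]
    [AddCommGroup Z] [Module R Z] (g : G →ₗ[R] Z) (hg : Function.Surjective g)
    (hG : ∀ i < d, EZ R (IsLocalRing.ResidueField R) G i)
    (hZ : ∀ i < d, EZ R (IsLocalRing.ResidueField R) Z i) :
    ∀ i < d, EZ R (IsLocalRing.ResidueField R) (LinearMap.ker g) i := by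
  intro i hi
  cases i with
  | zero =>
    intro x
    apply cov_inj0 (LinearMap.ker g).subtype (Submodule.subtype_injective _)
    rw [hG 0 hi (push _ x), map_zero]
  | succ i =>
    exact EZ_cov_left (LinearMap.ker g).subtype g (Submodule.subtype_injective _) hg
      (ker_exact g hg) (hZ i (by lia)) (hG _ hi)

theorem gdim_TR (hD : Dep R d) (n : ℕ) : ∀ (X : ModuleCat.{u} R), GdimLE R n X →
    Module.Finite R X → (∀ i < d, EZ R (IsLocalRing.ResidueField R) X i) → TR R X := by
  induction n with
  | zero => exact fun X h _ _ => TR_of h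
  | succ n ih =>
    rintro X ⟨G, g, hGf, hG, hg, hK⟩ _ hX
    have hG := TR_of hG
    have hKd := depth_ker g hg (fun i hi => depth_TR hD hG hi) hX
    have hKT := ih _ hK (inferInstanceAs (Module.Finite R (LinearMap.ker g))) hKd
    exact (Zquot hD hKT hG (LinearMap.ker g).subtype g (Submodule.subtype_injective _) hg
      (ker_exact g hg) fun i hi => hX i (by lia)).2

theorem free_TR {F : Type u} [AddCommGroup F] [Module R F] [Module.Finite R F] [Module.Free R F] :
    TR R F :=
  ⟨Module.bijective_dual_eval R F, fun _ => EZ_proj, fun _ => EZ_proj⟩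

theorem pd_lt (n : ℕ) : ∀ (X : ModuleCat.{u} R), PdLE R n X →
    HasProjectiveDimensionLT X (n + 1) := by
  induction n with
  | zero =>
    intro X h
    have : Module.Projective R X := h
    have : Projective X := (IsProjective.iff_projective X).1 this
    infer_instance
  | succ n ih =>
    rintro X ⟨G, g, hG, hg, hK⟩
    have h := ih _ hK
    have hG' : Projective G := (IsProjective.iff_projective G).1 hG
    have hs := ses (LinearMap.ker g).subtype g (Submodule.subtype_injective _) hg
      (ker_exact g hg)
    have h2 : HasProjectiveDimensionLT G (n + 2) := hasProjectiveDimensionLT_of_ge G 1 _ (by lia)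
    exact hs.hasProjectiveDimensionLT_X₃ (n + 1) h h2

theorem pd_proj (hD : Dep R d) (n : ℕ) : ∀ (X : Type u) [AddCommGroup X] [Module R X]
    [Module.Finite R X], HasProjectiveDimensionLT (ModuleCat.of R X) (n + 1) →
    (∀ i < d, EZ R (IsLocalRing.ResidueField R) X i) → Module.Projective R X := by
  induction n with
  | zero =>
    intro X _ _ _ h _
    have : Projective (ModuleCat.of R X) :=
      projective_iff_hasProjectiveDimensionLT_one.2 h
    exact (IsProjective.iff_projective X).2 this
  | succ n ih =>
    intro X _ _ _ h hX
    obtain ⟨m, p, hp⟩ := Module.Finite.exists_fin' R X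
    have hs := ses (LinearMap.ker p).subtype p (Submodule.subtype_injective _) hp
      (ker_exact p hp)
    have hF : Projective (ModuleCat.of R (Fin m → R)) := 
      (IsProjective.iff_projective _).1 inferInstance
    have hK : HasProjectiveDimensionLT (ModuleCat.of R (LinearMap.ker p)) (n + 1) := by
      have h2 : HasProjectiveDimensionLT (ModuleCat.of R (Fin m → R)) (n + 1) :=
        hasProjectiveDimensionLT_of_ge _ 1 _ (by lia)
      exact hs.hasProjectiveDimensionLT_X₁ (n + 1) h2 h
    have hKP := ih (LinearMap.ker p) hK (depth_ker p hp
      (fun i hi => depth_TR hD free_TR hi) hX)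
    have hKF : Module.Free R (LinearMap.ker p) := Module.free_of_flat_of_isLocalRing
    have hsur := (Zquot hD (free_TR (F := LinearMap.ker p)) free_TR (LinearMap.ker p).subtype p
      (Submodule.subtype_injective _) hp (ker_exact p hp) fun i hi => hX i (by lia)).1
    refine (IsProjective.iff_projective X).2 ?_
    rw [projective_iff_subsingleton_ext_one]
    intro Y
    refine subsingleton_of_forall_eq 0 (con_right_one (Y := Y) (LinearMap.ker p).subtype p
      (Submodule.subtype_injective _) hp (ker_exact p hp) ?_ EZ_proj)
    intro u
    let b := Module.Free.chooseBasis R (LinearMap.ker p)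
    choose c hc using fun i => hsur (b.coord i)
    refine ⟨∑ i, (c i).smulRight (u (b i)), ?_⟩
    ext1 x
    conv_rhs => rw [← b.sum_repr x, map_sum]
    simp only [LinearMap.comp_apply, LinearMap.sum_apply]
    refine Finset.sum_congr rfl fun i _ => ?_
    rw [map_smul]
    have := LinearMap.congr_fun (hc i) x
    simp only [pre_apply] at this
    rw [LinearMap.smulRight_apply, this]; rfl

end localring2

section main

variable [IsLocalRing R] [IsNoetherianRing R] {d : ℕ}

theorem refl_of (hD : Dep R d) {M : Type u} [AddCommGroup M] [Module R M] [Module.Finite R M]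
    (h1 : ∀ j, 1 ≤ j → j ≤ d → EZ R M R j) (hT : TR R (M →ₗ[R] R)) :
    Function.Bijective (evl (R := R) M) := by
  obtain ⟨n0, p0, hp0⟩ := Module.Finite.exists_fin' R M
  obtain ⟨n1, p1, hp1⟩ := Module.Finite.exists_fin' R (LinearMap.ker p0)
  obtain ⟨hs0, hT1⟩ := Zquot hD hT (free_TR (F := (Fin n0 → R) →ₗ[R] R)) (pre R p0)
    (resK p0 R).rangeRestrict (pre_inj p0 hp0) (LinearMap.surjective_rangeRestrict _)
    (pre_exact p0 hp0) (fun i hi => QQ_zero (fun l hl => hD.z l (by lia)) p0 hp0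
      fun j h h' => h1 j h (by lia))
  let f1 : ↥(QQ p0 R) →ₗ[R] ((Fin n1 → R) →ₗ[R] R) := (pre R p1).comp (QQ p0 R).subtype
  have hs1 : Function.Surjective (pre (R := R) (N' := ↥(QQ p0 R))
      (N := (Fin n1 → R) →ₗ[R] R) R f1) := by
    apply Sh hD hT1 (free_TR (F := (Fin n1 → R) →ₗ[R] R))
    intro a b hab
    have hab : push (pre R p1) (push (QQ p0 R).subtype a) =
        push (pre R p1) (push (QQ p0 R).subtype b) := by
      rw [push_push, push_push]; exact hab
    refine QQ_inj p0 hp0 ?_ (push_pre_inj hD.z p1 hp1 ?_ hab)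
    · rcases Nat.eq_zero_or_pos d with h | h
      · exact Or.inl h
      · exact Or.inr (h1 1 le_rfl h)
    · intro j hj1 hj2
      obtain ⟨j, rfl⟩ : ∃ j', j = j' + 1 := ⟨j - 1, by lia⟩
      exact ker_EZ p0 hp0 (h1 _ (by lia) (by lia))
  constructor
  · rw [injective_iff_map_eq_zero]
    intro x hx
    obtain ⟨y, rfl⟩ := hp0 x
    have hy : ∀ h : (Fin n0 → R) →ₗ[R] R, resK p0 R h = 0 → h y = 0 := by
      intro h hh
      obtain ⟨w, rfl⟩ := (pre_exact p0 hp0 h).1 (Subtype.ext hh)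
      exact LinearMap.congr_fun hx w
    have hq : Function.Surjective (resK p0 R).rangeRestrict :=
      LinearMap.surjective_rangeRestrict _
    obtain ⟨θ, hθ⟩ := (pre_exact (R := R) (L := R) (N := ↥(QQ p0 R))
      (F := (Fin n0 → R) →ₗ[R] R) (resK p0 R).rangeRestrict
      hq (evl (R := R) (Fin n0 → R) y)).1 (by
        apply Subtype.ext
        ext z
        have hz : (resK p0 R).rangeRestrict z.1 = 0 := z.2
        exact hy z.1 (congrArg Subtype.val hz))
    obtain ⟨Θ, hΘ⟩ := hs1 θ
    obtain ⟨z, rfl⟩ := (free_TR (F := Fin n1 → R)).bij'.2 Θ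
    have key : ∀ h : (Fin n0 → R) →ₗ[R] R, h y = h (p1 z).1 := by
      intro h
      have e1 := LinearMap.congr_fun hθ h
      rw [← hΘ] at e1
      exact e1.symm
    have : y = (p1 z).1 := by
      funext i
      exact key (LinearMap.proj i)
    rw [this]
    exact (p1 z).2
  · intro Θ
    obtain ⟨Θ', hΘ⟩ := hs0 Θ
    obtain ⟨y, rfl⟩ := (free_TR (F := Fin n0 → R)).bij'.2 Θ'
    exact ⟨p0 y, hΘ⟩

theorem exists_unit (hD : Dep R d) {M : Type u} [AddCommGroup M] [Module R M] [Module.Finite R M]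
    [Nontrivial M] (hM : Function.Bijective (evl (R := R) M))
    (hE : ∀ j, EZ R (M →ₗ[R] R) R (j + 1))
    (hMd : ∀ i < d, EZ R (IsLocalRing.ResidueField R) M i)
    (h2 : ∀ j, 1 ≤ j → j ≤ d → EZ R M M j) [Module.Free R (M →ₗ[R] M)] :
    ∃ (f : M →ₗ[R] R) (x : M), IsUnit (f x) := by
  by_contra hcon
  push Not at hcon
  obtain ⟨v, hv⟩ := hD.nz
  let ι : R →ₗ[R] (M →ₗ[R] M) := LinearMap.toSpanSingleton R _ LinearMap.id
  have h0 : push ι v = 0 := by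
    refine hom_inj hMd (fun j h _ => h2 j h (by lia)) _ fun x => ?_
    apply push_inj_of_bijective (evl M) hM
    rw [map_zero]
    refine hom_inj hD.z (fun j h _ => ?_) _ fun f => ?_
    · obtain ⟨j, rfl⟩ : ∃ j', j = j' + 1 := ⟨j - 1, by lia⟩
      exact hE j
    · rw [push_push, push_push, push_push]
      have : ((ev R f ∘ₗ evl M) ∘ₗ ev M x) ∘ₗ ι = f x • LinearMap.id := by
        ext
        change f ((1 : R) • x) = f x • 1
        simp
      rw [this, push_smul, push_id]
      exact max_smul _ (hcon f x) v
  let b := Module.Free.chooseBasis R (M →ₗ[R] M)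
  obtain ⟨i, hi⟩ : ∃ i, IsUnit (b.coord i LinearMap.id) := by
    by_contra hc
    push Not at hc
    have htop : (⊤ : Submodule R M) ≤ IsLocalRing.maximalIdeal R • (⊤ : Submodule R M) := by
      intro x _
      have : x = ∑ i, (b.repr LinearMap.id i) • (b i x) := by
        conv_lhs => rw [← LinearMap.id_apply (R := R) x, ← b.sum_repr LinearMap.id]
        simp only [LinearMap.sum_apply, LinearMap.smul_apply]
      rw [this]
      exact Submodule.sum_mem _ fun i _ => Submodule.smul_mem_smul (hc i) trivial
    have hbot := Submodule.eq_bot_of_le_smul_of_le_jacobson_bot (IsLocalRing.maximalIdeal R)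
      (⊤ : Submodule R M) Module.Finite.fg_top htop (IsLocalRing.maximalIdeal_le_jacobson _)
    exact bot_ne_top hbot.symm
  obtain ⟨w, hw⟩ := hi
  apply hv
  apply push_inj_of_retract ι ((↑w⁻¹ : R) • b.coord i) ?_ (h0.trans (map_zero _).symm)
  ext
  change (↑w⁻¹ : R) • b.coord i ((1 : R) • LinearMap.id) = 1
  rw [one_smul, ← hw]
  simp

theorem main (hD : Dep R d) {M : Type u} [AddCommGroup M] [Module R M] [Module.Finite R M]
    (hG : FiniteGdim R (M →ₗ[R] R)) (hpd : FinitePd R (M →ₗ[R] M))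
    (h1 : ∀ j, 1 ≤ j → j ≤ d → EZ R M R j) (h2 : ∀ j, 1 ≤ j → j ≤ d → EZ R M M j) :
    Module.Free R M := by
  rcases subsingleton_or_nontrivial M with hs | hn
  · infer_instance
  obtain ⟨n, hG⟩ := hG
  have hT : TR R (M →ₗ[R] R) := gdim_TR hD n _ hG
    (inferInstanceAs (Module.Finite R (M →ₗ[R] R)))
    fun i hi => hom_zero (fun l hl => hD.z l (by lia)) M fun j h _ => h1 j h (by lia)
  have hM := refl_of hD h1 hT
  have hMd : ∀ i < d, EZ R (IsLocalRing.ResidueField R) M i := by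
    intro i hi
    refine EZ_congr_right (LinearEquiv.ofBijective (evl M) hM) ?_
    refine hom_zero (fun l hl => hD.z l (by lia)) (M →ₗ[R] R) fun j h _ => ?_
    obtain ⟨j, rfl⟩ : ∃ j', j = j' + 1 := ⟨j - 1, by lia⟩
    exact hT.e j
  obtain ⟨m, hpd⟩ := hpd
  have hA : Module.Projective R (M →ₗ[R] M) := pd_proj hD m _ (pd_lt m _ hpd)
    fun i hi => hom_zero (fun l hl => hMd l (by lia)) M fun j h _ => h2 j h (by lia)
  have hAF : Module.Free R (M →ₗ[R] M) := Module.free_of_flat_of_isLocalRing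
  obtain ⟨f, x, w, hw⟩ := exists_unit hD hM hT.e hMd h2
  have hP : Module.Projective R M := by
    refine Module.Projective.of_split (M := M →ₗ[R] M)
      (LinearMap.smulRightₗ f) ((↑w⁻¹ : R) • ev M x) ?_
    ext y
    change (↑w⁻¹ : R) • f x • y = y
    rw [← hw, smul_smul]
    simp
  exact Module.free_of_flat_of_isLocalRing

theorem dep_of (hCM : IsCMLocalOfDim R d) : Dep R d := by
  have h := hCM.2
  unfold moduleDepth at h
  constructor
  · intro i hi
    rw [EZ_iff]
    by_contra hc
    rw [not_subsingleton_iff_nontrivial] at hc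
    have : (d : ℕ∞) ≤ i := h ▸ sInf_le ⟨i, rfl, hc⟩
    exact absurd (Nat.cast_le.1 this) (by lia)
  · have hne : {i : ℕ∞ | ∃ n : ℕ, i = n ∧ Nontrivial (ExtMod R
        (ModuleCat.of R (IsLocalRing.ResidueField R)) (ModuleCat.of R R) n)}.Nonempty := by
      by_contra hc
      rw [Set.not_nonempty_iff_eq_empty] at hc
      rw [hc, sInf_empty] at h
      exact ENat.natCast_ne_top d h.symm
    obtain ⟨n, hn, hnt⟩ := csInf_mem hne
    rw [h] at hn
    obtain rfl : d = n := by exact_mod_cast hn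
    by_contra hc
    push Not at hc
    have : EZ R (IsLocalRing.ResidueField R) R d := hc
    rw [EZ_iff, ← not_nontrivial_iff_subsingleton] at this
    exact this hnt

end main

end S5

theorem stmt5 (R : Type u) [CommRing R] [IsLocalRing R] [IsNoetherianRing R] (d : ℕ)
    (hCM : IsCMLocalOfDim R d)
    (M : Type u) [AddCommGroup M] [Module R M] [Module.Finite R M]
    (hG : FiniteGdim R (M →ₗ[R] R))
    (hpd : FinitePd R (M →ₗ[R] M))
    (h1 : ∀ i : ℕ, 1 ≤ i → i ≤ d →
      Subsingleton (ExtMod R (ModuleCat.of R M) (ModuleCat.of R R) i))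
    (h2 : ∀ j : ℕ, 1 ≤ j → j ≤ d →
      Subsingleton (ExtMod R (ModuleCat.of R M) (ModuleCat.of R M) j)) :
    Module.Free R M := by
  exact S5.main (S5.dep_of hCM) hG hpd (fun j h h' => S5.EZ_iff.2 (h1 j h h'))
    (fun j h h' => S5.EZ_iff.2 (h2 j h h'))
end
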